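/- arXiv:1511.03381 — 2 statements merged into one kernel-verified Lean document; each statement's English description precedes it below -/
import Mathlib

section
/- Let d ≥ 3, a ≥ 0, and let T ∈ GL(d) satisfy ‖T‖ ≤ 2 and ‖T^{-1}‖ ≤ 2 (operator norms). Then for every δ > 0 there exists a constant C_δ > 0 (depending only on d, a, δ) such that for every f in the class U_a, ‖Tf‖_{U_{a-δ}} ≤ C_δ ‖f‖_{U_a}, where (Tf)(x) = f(Tx/|Tx|)|Tx|^{-(d+1)}. -/
open MeasureTheory Metric Filter Topology
open scoped Pointwise ENNReal

noncomputable section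

abbrev Ed (d : ℕ) := EuclideanSpace ℝ (Fin d)

def sphereSet (d : ℕ) : Set (Ed d) := Metric.sphere 0 1

/-- The surface measure on the unit sphere `S^{d-1} ⊆ ℝ^d`, realized as the
`(d-1)`-dimensional Hausdorff measure restricted to the sphere. -/
def sphereMeasure (d : ℕ) : Measure (Ed d) := (μH[(d : ℝ) - 1]).restrict (sphereSet d)

/-- `L²` norm of a function on the sphere `S^{d-1}`. -/
def L2norm (d : ℕ) (f : Ed d → ℝ) : ℝ := Real.sqrt (∫ x, f x ^ 2 ∂ sphereMeasure d)

/-- sup norm of a function on the sphere `S^{d-1}`. -/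
def supNorm (d : ℕ) (f : Ed d → ℝ) : ℝ := sSup ((fun x => |f x|) '' sphereSet d)

/-- The set of admissible constants `M` in the definition of the norm `‖f‖_{U_a}`. -/
def UaSet (d : ℕ) (a : ℝ) (f : Ed d → ℝ) : Set ℝ :=
  {M | 0 < M ∧ BddAbove ((fun x => |f x|) '' sphereSet d) ∧ supNorm d f < M ∧
    ∀ n : ℕ, 0 < n → ∃ p : MvPolynomial (Fin d) ℝ, p.totalDegree ≤ n ∧
      L2norm d (fun x => f x - MvPolynomial.eval (fun i => x i) p) < M * (n : ℝ) ^ (-a)}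

/-- Membership in the class `U_a`. -/
def MemUa (d : ℕ) (a : ℝ) (f : Ed d → ℝ) : Prop := (UaSet d a f).Nonempty

/-- The norm `‖f‖_{U_a}`. -/
def UaNorm (d : ℕ) (a : ℝ) (f : Ed d → ℝ) : ℝ := sInf (UaSet d a f)

/-- The `(d-2)`-dimensional surface measure on the subsphere `S^{d-1} ∩ x^⊥`. -/
def subSphere (d : ℕ) (x : Ed d) : Measure (Ed d) :=
  (μH[(d : ℝ) - 2]).restrict (sphereSet d ∩ {y | (inner ℝ x y : ℝ) = 0})

/-- Iterated integral of a function of `n` variables with respect to a measure `μ`. -/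
def iterInt {α : Type*} [MeasurableSpace α] : (n : ℕ) → Measure α → ((Fin n → α) → ℝ) → ℝ
  | 0, _, F => F (fun i => i.elim0)
  | n + 1, μ, F => ∫ t, iterInt n μ (fun v => F (Fin.cons t v)) ∂μ

/-- For `x ∈ S^{d-1}` and `x_1, …, x_{d-1} ∈ x^⊥`, the determinant of `x_1, …, x_{d-1}`
with respect to an orthonormal basis of `x^⊥` coincides, up to sign, with the `d × d`
determinant of the vectors `x_1, …, x_{d-1}, x`; we use the latter. -/
def detCols (d : ℕ) (v : Fin (d - 1) → Ed d) (x : Ed d) : ℝ :=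
  Matrix.det (Matrix.of (fun (i j : Fin d) =>
    if h : (j : ℕ) < d - 1 then v ⟨(j : ℕ), h⟩ i else x i))

def QInt (d : ℕ) (g : Fin (d - 1) → Ed d → ℝ) (x : Ed d) : ℝ :=
  iterInt (d - 1) (subSphere d x) (fun v => detCols d v x ^ 2 * ∏ k, g k (v k))

/-- The normalizing constant `c_d`, chosen so that `Q(1, …, 1) = 1`. -/
def cQ (d : ℕ) : ℝ :=
  if h : 0 < d then (QInt d (fun _ _ => 1) (EuclideanSpace.single (⟨0, h⟩ : Fin d) 1))⁻¹ else 1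

/-- The transform `Q(g_1, …, g_{d-1})`. -/
def Qfun (d : ℕ) (g : Fin (d - 1) → Ed d → ℝ) (x : Ed d) : ℝ := cQ d * QInt d g x

/-- The total surface measure `|S^{n-1}|` of the unit sphere in `ℝ^n`. -/
def sphVol (n : ℕ) : ℝ := (μH[(n : ℝ) - 1] (Metric.sphere (0 : EuclideanSpace ℝ (Fin n)) 1)).toReal

/-- The normalized Radon transform, `R(1) = 1`. -/
def Radon (d : ℕ) (f : Ed d → ℝ) (x : Ed d) : ℝ :=
  (sphVol (d - 1))⁻¹ * ∫ y, f y ∂ subSphere d x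

def IsConvexBody (d : ℕ) (K : Set (Ed d)) : Prop :=
  Convex ℝ K ∧ IsCompact K ∧ (interior K).Nonempty

/-- Support function of a set. -/
def suppFn (d : ℕ) (K : Set (Ed d)) (u : Ed d) : ℝ := sSup ((fun y => (inner ℝ u y : ℝ)) '' K)

/-- Orthogonal projection onto the hyperplane `u^⊥` (for a unit vector `u`). -/
def projHyp (d : ℕ) (u : Ed d) (y : Ed d) : Ed d := y - (inner ℝ y u : ℝ) • u

/-- `P` is the projection body of `K`: its support function at a unit vector `u` is the
`(d-1)`-volume of the projection of `K` to `u^⊥`. -/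
def IsProjBody (d : ℕ) (K P : Set (Ed d)) : Prop :=
  IsConvexBody d P ∧
    ∀ u : Ed d, ‖u‖ = 1 → suppFn d P u = (μH[(d : ℝ) - 1] (projHyp d u '' K)).toReal

/-- `K` has absolutely continuous surface area measure with curvature function `f`:
the surface area measure of every Borel subset `ω` of the sphere (that is, the
`(d-1)`-dimensional Hausdorff measure of the set of boundary points of `K` having an outer
unit normal in `ω`) equals `∫_ω f`. -/
def HasCurvatureFn (d : ℕ) (K : Set (Ed d)) (f : Ed d → ℝ) : Prop :=
  ∀ ω : Set (Ed d), MeasurableSet ω → ω ⊆ sphereSet d →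
    μH[(d : ℝ) - 1] {x | x ∈ frontier K ∧
        ∃ u ∈ ω, ∀ y ∈ K, (inner ℝ u y : ℝ) ≤ (inner ℝ u x : ℝ)} =
      ENNReal.ofReal (∫ y in ω, f y ∂ sphereMeasure d)

/-- Banach–Mazur distance. -/
def bmDist (d : ℕ) (K L : Set (Ed d)) : ℝ :=
  sInf {t : ℝ | 1 ≤ t ∧ ∃ T : Ed d ≃L[ℝ] Ed d, L ⊆ T '' K ∧ T '' K ⊆ t • L}

/-- Action `(Tf)(x) = f(Tx/|Tx|) |Tx|^{-(d+1)}`. -/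
def Tact (d : ℕ) (T : Ed d ≃L[ℝ] Ed d) (f : Ed d → ℝ) (x : Ed d) : ℝ :=
  f ((‖T x‖)⁻¹ • T x) * ‖T x‖ ^ (-((d : ℝ) + 1))

/-- Action `(T̂f)(x) = f(Tx/|Tx|) |Tx|^{-1}`. -/
def hatAct (d : ℕ) (T : Ed d ≃L[ℝ] Ed d) (f : Ed d → ℝ) (x : Ed d) : ℝ :=
  f ((‖T x‖)⁻¹ • T x) * (‖T x‖)⁻¹

/-- `h` is (the restriction to the sphere of) a spherical harmonic of degree `k`:
a harmonic polynomial, homogeneous of degree `k`. -/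
def SphHarm (d k : ℕ) (h : Ed d → ℝ) : Prop :=
  ∃ p : MvPolynomial (Fin d) ℝ, p.IsHomogeneous k ∧
    (∑ i : Fin d, MvPolynomial.pderiv i (MvPolynomial.pderiv i p)) = 0 ∧
    ∀ x ∈ sphereSet d, h x = MvPolynomial.eval (fun i => x i) p

/-- `h` is the degree-`2` spherical harmonic component `H_2^ψ` of `ψ`. -/
def IsDeg2Part (d : ℕ) (ψ h : Ed d → ℝ) : Prop :=
  SphHarm d 2 h ∧ ∀ g : Ed d → ℝ, SphHarm d 2 g →
    ∫ x, (ψ x - h x) * g x ∂ sphereMeasure d = 0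

def unitBall (d : ℕ) : Set (Ed d) := Metric.closedBall 0 1

/-- `W` is the sequence of quermassintegrals of `K`, via the Steiner formula. -/
def IsQuermass (d : ℕ) (K : Set (Ed d)) (W : ℕ → ℝ) : Prop :=
  ∀ t : ℝ, 0 ≤ t → (volume (K + t • unitBall d)).toReal =
    ∑ i ∈ Finset.range (d + 1), (d.choose i : ℝ) * W i * t ^ i

/-- `W` is the sequence of quermassintegrals of `A ⊆ u^⊥` computed within the
`(d-1)`-dimensional space `u^⊥`, via the Steiner formula in `u^⊥`. -/
def IsQuermassHyp (d : ℕ) (u : Ed d) (A : Set (Ed d)) (W : ℕ → ℝ) : Prop :=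
  ∀ t : ℝ, 0 ≤ t →
    (μH[(d : ℝ) - 1] (A + t • (unitBall d ∩ {y | (inner ℝ u y : ℝ) = 0}))).toReal =
      ∑ i ∈ Finset.range d, ((d - 1).choose i : ℝ) * W i * t ^ i

/-- `P` is the `i`-th projection body `Π_i K` of `K`. -/
def IsIthProjBody (d : ℕ) (i : ℕ) (K P : Set (Ed d)) : Prop :=
  IsConvexBody d P ∧ ∀ u : Ed d, ‖u‖ = 1 →
    ∀ W : ℕ → ℝ, IsQuermassHyp d u (projHyp d u '' K) W → suppFn d P u = W i

/-- `ω_n`, the volume of the `n`-dimensional Euclidean unit ball. -/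
def ballVol (n : ℕ) : ℝ := (volume (Metric.closedBall (0 : EuclideanSpace ℝ (Fin n)) 1)).toReal

/-- A set is centrally symmetric if some translate of it equals its reflection in the origin. -/
def IsCentSymm (d : ℕ) (K : Set (Ed d)) : Prop := ∃ v : Ed d, (fun x => x + v) '' K = -K


lemma normalize_sub_le {E : Type*} [NormedAddCommGroup E] [NormedSpace ℝ E] (u v : E)
    (hu : u ≠ 0) (hv : v ≠ 0) :
    ‖‖u‖⁻¹ • u - ‖v‖⁻¹ • v‖ ≤ 2 * ‖u‖⁻¹ * ‖u - v‖ := by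
  have hu' : 0 < ‖u‖ := norm_pos_iff.2 hu
  have hv' : 0 < ‖v‖ := norm_pos_iff.2 hv
  have e : ‖u‖⁻¹ • u - ‖v‖⁻¹ • v = ‖u‖⁻¹ • (u - v) + (‖u‖⁻¹ - ‖v‖⁻¹) • v := by
    rw [smul_sub, sub_smul]; abel
  have e2 : ‖u‖⁻¹ - ‖v‖⁻¹ = ‖u‖⁻¹ * ‖v‖⁻¹ * (‖v‖ - ‖u‖) := by field_simp
  have h3 : |‖v‖ - ‖u‖| ≤ ‖u - v‖ := by rw [norm_sub_rev u v]; exact abs_norm_sub_norm_le v u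
  rw [e]
  refine (norm_add_le _ _).trans ?_
  rw [norm_smul, norm_smul, e2, Real.norm_eq_abs, Real.norm_eq_abs, abs_mul, abs_mul,
    abs_of_pos (inv_pos.2 hu'), abs_of_pos (inv_pos.2 hv')]
  have : ‖u‖⁻¹ * ‖v‖⁻¹ * |‖v‖ - ‖u‖| * ‖v‖ = ‖u‖⁻¹ * |‖v‖ - ‖u‖| := by field_simp
  rw [this]
  have : ‖u‖⁻¹ * |‖v‖ - ‖u‖| ≤ ‖u‖⁻¹ * ‖u - v‖ := by gcongr
  linarith

lemma sphere_finite (m : ℕ) : μH[(m : ℝ)] (sphereSet (m + 1)) < ⊤ := by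
  classical
  set B : Set (Fin m → ℝ) := Set.Icc (fun _ => -1) (fun _ => 1)
  have hB : μH[(m : ℝ)] B < ⊤ := by
    have : (μH[(m : ℝ)] : Measure (Fin m → ℝ)) = volume := by
      have := hausdorffMeasure_pi_real (ι := Fin m)
      simpa using this
    rw [this]
    exact isCompact_Icc.measure_lt_top
  let g : Fin (m + 1) → Bool → (Fin m → ℝ) → Ed (m + 1) := fun i σ v =>
    WithLp.toLp 2 (Fin.insertNth (α := fun _ => ℝ) i (if σ then 1 else -1) v)
  have gL : ∀ i σ, ∃ K, LipschitzWith K (g i σ) := by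
    intro i σ
    have h1 := PiLp.lipschitzWith_toLp 2 (fun _ : Fin (m + 1) => ℝ)
    have h2 : LipschitzWith 1
        (fun v : Fin m → ℝ => Fin.insertNth (α := fun _ => ℝ) i (if σ then (1:ℝ) else -1) v) := by
      refine LipschitzWith.of_edist_le fun v w => ?_
      rw [edist_pi_le_iff]
      intro j
      refine Fin.succAboveCases i ?_ (fun j => ?_) j
      · simp
      · simpa using edist_le_pi_edist v w j
    exact ⟨_, h1.comp h2⟩
  have gn : ∀ i σ v, 1 ≤ ‖g i σ v‖ := by
    intro i σ v
    have := PiLp.norm_apply_le (g i σ v) i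
    refine le_trans (le_of_eq ?_) this
    simp [g]
    split_ifs <;> simp
  have cover : sphereSet (m + 1) ⊆ ⋃ i, ⋃ σ, (fun v => ‖g i σ v‖⁻¹ • g i σ v) '' B := by
    intro x hx
    have hx1 : ‖x‖ = 1 := by simpa [sphereSet] using hx
    obtain ⟨i, hi⟩ := Finite.exists_max (fun i => |x i|)
    have hxi : x i ≠ 0 := by
      intro h0
      have : x = 0 := by
        ext j
        have := hi j
        rw [h0, abs_zero] at this
        simpa using abs_nonpos_iff.1 this
      rw [this] at hx1; simp at hx1
    have hxp : 0 < |x i| := abs_pos.2 hxi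
    simp only [Set.mem_iUnion]
    refine ⟨i, decide (0 < x i), fun j => |x i|⁻¹ * x (i.succAbove j), ?_, ?_⟩
    · rw [Set.mem_Icc, Pi.le_def, Pi.le_def, ← forall_and]
      intro j
      rw [← abs_le, abs_mul, abs_inv, abs_abs, inv_mul_le_one₀ hxp]
      exact hi _
    · have e : g i (decide (0 < x i)) (fun j => |x i|⁻¹ * x (i.succAbove j)) = |x i|⁻¹ • x := by
        ext j
        refine Fin.succAboveCases i ?_ (fun j => ?_) j
        · simp only [g, Fin.insertNth_apply_same, PiLp.smul_apply, smul_eq_mul]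
          rcases lt_or_gt_of_ne hxi with h | h
          · rw [abs_of_neg h]; simp [not_lt.2 h.le]; field_simp
          · rw [abs_of_pos h]; simp [h]; field_simp
        · simp [g]
      simp only [e]
      rw [norm_smul, hx1]
      simp [smul_smul, hxi]
  refine (measure_mono cover).trans_lt ?_
  refine (measure_iUnion_le _).trans_lt ?_
  rw [tsum_fintype, ENNReal.sum_lt_top]
  intro i _
  refine (measure_iUnion_le _).trans_lt ?_
  rw [tsum_fintype, ENNReal.sum_lt_top]
  intro σ _
  obtain ⟨K, hK⟩ := gL i σ
  have L : LipschitzWith (2 * K) (fun v => ‖g i σ v‖⁻¹ • g i σ v) := by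
    refine LipschitzWith.of_dist_le_mul fun v w => ?_
    have a1 := gn i σ v
    have a2 := gn i σ w
    have := normalize_sub_le (g i σ v) (g i σ w) (norm_pos_iff.1 (by linarith))
      (norm_pos_iff.1 (by linarith))
    rw [dist_eq_norm]
    refine this.trans ?_
    have h3 := hK.dist_le_mul v w
    rw [dist_eq_norm] at h3
    have h4 : ‖g i σ v‖⁻¹ ≤ 1 := inv_le_one_of_one_le₀ a1
    push_cast
    calc _ ≤ 2 * 1 * (K * dist v w) := by gcongr
      _ = _ := by ring
  refine (L.lipschitzOnWith.hausdorffMeasure_image_le (s := B) (by positivity)).trans_lt ?_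
  exact ENNReal.mul_lt_top (ENNReal.rpow_lt_top_of_nonneg (by positivity) ENNReal.coe_ne_top) hB

def nmap (d : ℕ) (T : Ed d ≃L[ℝ] Ed d) (x : Ed d) : Ed d := (‖T x‖)⁻¹ • T x

lemma half_le (d : ℕ) (T : Ed d ≃L[ℝ] Ed d) (h2 : ‖(T.symm : Ed d →L[ℝ] Ed d)‖ ≤ 2)
    (x : Ed d) (hx : ‖x‖ = 1) : 1 / 2 ≤ ‖T x‖ := by
  have := (T.symm : Ed d →L[ℝ] Ed d).le_of_opNorm_le h2 (T x)
  simp at this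
  linarith

lemma le_two (d : ℕ) (T : Ed d ≃L[ℝ] Ed d) (h2 : ‖(T : Ed d →L[ℝ] Ed d)‖ ≤ 2)
    (x : Ed d) (hx : ‖x‖ = 1) : ‖T x‖ ≤ 2 := by
  have := (T : Ed d →L[ℝ] Ed d).le_of_opNorm_le h2 x
  simpa [hx] using this

lemma nmap_meas (d : ℕ) (T : Ed d ≃L[ℝ] Ed d) : Measurable (nmap d T) := by
  unfold nmap
  exact (T.continuous.measurable.norm.inv).smul T.continuous.measurable

lemma nmap_mem (d : ℕ) (T : Ed d ≃L[ℝ] Ed d) (x : Ed d) (hx : x ∈ sphereSet d) :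
    nmap d T x ∈ sphereSet d := by
  have hx1 : ‖x‖ = 1 := by simpa [sphereSet] using hx
  have : T x ≠ 0 := by
    simp; rintro rfl; simp at hx1
  simp [nmap, sphereSet, norm_smul, this]

lemma nmap_inv (d : ℕ) (T : Ed d ≃L[ℝ] Ed d) (x : Ed d) (hx : x ∈ sphereSet d) :
    nmap d T.symm (nmap d T x) = x := by
  have hx1 : ‖x‖ = 1 := by simpa [sphereSet] using hx
  have h0 : T x ≠ 0 := by
    simp; rintro rfl; simp at hx1
  have : ‖T x‖ ≠ 0 := norm_ne_zero_iff.2 h0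
  simp [nmap, norm_smul, smul_smul, hx1, this]

lemma nmap_lip (d : ℕ) (T : Ed d ≃L[ℝ] Ed d) (h1 : ‖(T : Ed d →L[ℝ] Ed d)‖ ≤ 2)
    (h2 : ‖(T.symm : Ed d →L[ℝ] Ed d)‖ ≤ 2) : LipschitzOnWith 8 (nmap d T) (sphereSet d) := by
  refine LipschitzOnWith.of_dist_le_mul fun x hx y hy => ?_
  have hx1 : ‖x‖ = 1 := by simpa [sphereSet] using hx
  have hy1 : ‖y‖ = 1 := by simpa [sphereSet] using hy
  have a1 := half_le d T h2 x hx1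
  have a2 := half_le d T h2 y hy1
  have := normalize_sub_le (T x) (T y) (norm_pos_iff.1 (by linarith)) (norm_pos_iff.1 (by linarith))
  rw [dist_eq_norm, dist_eq_norm]
  refine this.trans ?_
  have h3 := (T : Ed d →L[ℝ] Ed d).le_of_opNorm_le h1 (x - y)
  simp only [map_sub, ContinuousLinearEquiv.coe_coe] at h3
  have h4 : ‖T x‖⁻¹ ≤ 2 := by
    rw [inv_le_comm₀ (by linarith) (by norm_num)]; linarith
  calc _ ≤ 2 * 2 * (2 * ‖x - y‖) := by gcongr
    _ = _ := by push_cast; ring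

lemma sphereMeasure_finite (d : ℕ) (hd : 3 ≤ d) : IsFiniteMeasure (sphereMeasure d) := by
  obtain ⟨m, rfl⟩ : ∃ m, d = m + 1 := ⟨d - 1, by omega⟩
  have := sphere_finite m
  constructor
  rw [sphereMeasure, Measure.restrict_apply_univ]
  simpa using this

lemma sphere_measurable (d : ℕ) : MeasurableSet (sphereSet d) := isClosed_sphere.measurableSet

lemma map_le (d : ℕ) (hd : 3 ≤ d) (T : Ed d ≃L[ℝ] Ed d) (h1 : ‖(T : Ed d →L[ℝ] Ed d)‖ ≤ 2)
    (h2 : ‖(T.symm : Ed d →L[ℝ] Ed d)‖ ≤ 2) :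
    (sphereMeasure d).map (nmap d T) ≤ ((8 : ℝ≥0∞) ^ ((d : ℝ) - 1)) • sphereMeasure d := by
  have hd' : (0 : ℝ) ≤ (d : ℝ) - 1 := by
    have : (3 : ℝ) ≤ d := by exact_mod_cast hd
    linarith
  refine Measure.le_iff.2 fun A hA => ?_
  rw [Measure.map_apply (nmap_meas d T) hA, Measure.smul_apply, smul_eq_mul, sphereMeasure,
    Measure.restrict_apply (nmap_meas d T hA), Measure.restrict_apply hA]
  have sub : nmap d T ⁻¹' A ∩ sphereSet d ⊆ nmap d T.symm '' (A ∩ sphereSet d) := by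
    rintro x ⟨hxA, hx⟩
    exact ⟨nmap d T x, ⟨hxA, nmap_mem d T x hx⟩, nmap_inv d T x hx⟩
  refine (measure_mono sub).trans ?_
  have := ((nmap_lip d T.symm h2 (by simpa using h1)).mono
    (Set.inter_subset_right (s := A))).hausdorffMeasure_image_le hd'
  simpa using this

lemma nmap_qmp (d : ℕ) (hd : 3 ≤ d) (T : Ed d ≃L[ℝ] Ed d) (h1 : ‖(T : Ed d →L[ℝ] Ed d)‖ ≤ 2)
    (h2 : ‖(T.symm : Ed d →L[ℝ] Ed d)‖ ≤ 2) :
    Measure.QuasiMeasurePreserving (nmap d T) (sphereMeasure d) (sphereMeasure d) := by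
  refine ⟨nmap_meas d T, ?_⟩
  exact (Measure.absolutelyContinuous_of_le (map_le d hd T h1 h2)).trans
    (Measure.smul_absolutelyContinuous)

/-- square integral -/
def J (d : ℕ) (f : Ed d → ℝ) : ℝ := ∫ x, f x ^ 2 ∂ sphereMeasure d

lemma J_comp_le (d : ℕ) (hd : 3 ≤ d) (T : Ed d ≃L[ℝ] Ed d) (h1 : ‖(T : Ed d →L[ℝ] Ed d)‖ ≤ 2)
    (h2 : ‖(T.symm : Ed d →L[ℝ] Ed d)‖ ≤ 2) (g : Ed d → ℝ) (hg : MemLp g 2 (sphereMeasure d)) :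
    MemLp (fun x => g (nmap d T x)) 2 (sphereMeasure d) ∧
    J d (fun x => g (nmap d T x)) ≤ (8 : ℝ) ^ ((d : ℝ) - 1) * J d g := by
  have hK : ((8 : ℝ≥0∞) ^ ((d : ℝ) - 1)) ≠ ⊤ := by
    apply ENNReal.rpow_ne_top_of_nonneg
    · have : (3 : ℝ) ≤ d := by exact_mod_cast hd
      linarith
    · simp
  have hle := map_le d hd T h1 h2
  have hg2 := hg.smul_measure hK
  have hg3 := hg2.mono_measure hle
  have hm := (nmap_meas d T).aemeasurable (μ := sphereMeasure d)
  constructor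
  · exact (memLp_map_measure_iff hg3.aestronglyMeasurable hm).1 hg3
  · have e1 : J d (fun x => g (nmap d T x)) =
        ∫ y, g y ^ 2 ∂ ((sphereMeasure d).map (nmap d T)) := by
      rw [integral_map hm hg3.integrable_sq.aestronglyMeasurable]; rfl
    rw [e1]
    refine (integral_mono_measure hle (ae_of_all _ fun y => sq_nonneg _) hg2.integrable_sq).trans ?_
    rw [integral_smul_measure, J, smul_eq_mul]
    rw [← ENNReal.toReal_rpow]; simp


lemma choose_nn (s : ℝ) (hs : 0 < s) (n : ℕ) : 0 ≤ Ring.choose (s + n - 1) n := by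
  have h1 : Ring.choose (s + n - 1) n = Ring.multichoose s n := by
    unfold Ring.choose; congr 1; ring
  rw [h1]
  have h2 := Ring.factorial_nsmul_multichoose_eq_ascPochhammer s n
  have h3 : 0 < (Polynomial.eval s (ascPochhammer ℝ n)) := ascPochhammer_pos n s hs
  rw [Polynomial.ascPochhammer_smeval_eq_eval] at h2
  rw [← h2, nsmul_eq_mul] at h3
  have : (0:ℝ) < n.factorial := by positivity
  exact (pos_of_mul_pos_right h3 this.le).le

lemma choose_hasSum (s : ℝ) (x : ℝ) (hx : |x| < 1) :
    HasSum (fun n : ℕ => Ring.choose (s + n - 1) n * x ^ n) (1 / (1 - x) ^ s) := by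
  have h := (Real.one_div_one_sub_rpow_hasFPowerSeriesOnBall_zero s).hasSum (y := x)
    (by simpa [enorm_eq_nnnorm, ← NNReal.coe_lt_coe] using hx)
  simpa [FormalMultilinearSeries.ofScalars_apply_eq, mul_comm] using h

lemma approx (s : ℝ) (hs : 0 < s) (N : ℕ) : ∃ Q : Polynomial ℝ, Q.natDegree ≤ N ∧
    ∀ t ∈ Set.Icc (1/4 : ℝ) 4, |Q.eval t * t ^ s - 1| ≤ 34 ^ s * (15/16 : ℝ) ^ N := by
  set c : ℕ → ℝ := fun n => Ring.choose (s + n - 1) n with hc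
  have cnn : ∀ n, 0 ≤ c n := choose_nn s hs
  refine ⟨Polynomial.C ((17/8 : ℝ) ^ (-s)) * ∑ m ∈ Finset.range N, Polynomial.C (c m) *
    (1 - Polynomial.C (8/17) * Polynomial.X) ^ m, ?_, ?_⟩
  · refine (Polynomial.natDegree_C_mul_le _ _).trans ?_
    refine Polynomial.natDegree_sum_le_of_forall_le _ _ fun m hm => ?_
    refine (Polynomial.natDegree_C_mul_le _ _).trans ?_
    refine Polynomial.natDegree_pow_le.trans ?_
    have : (1 - Polynomial.C (8/17 : ℝ) * Polynomial.X).natDegree ≤ 1 := by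
      compute_degree
    have := Finset.mem_range.1 hm
    nlinarith
  · rintro t ⟨ht1, ht2⟩
    have htp : 0 < t := by linarith
    set u : ℝ := 1 - 8/17 * t with hu
    have hu1 : |u| ≤ 15/17 := by rw [abs_le]; constructor <;> linarith
    have e1 : (1 - u) = t / (17/8) := by rw [hu]; ring
    have H := choose_hasSum s u (by linarith)
    have H2 := choose_hasSum s (16/17) (by norm_num [abs_of_pos])
    rw [e1] at H
    have e2 : (1 : ℝ) / (1 - 16/17) ^ s = 17 ^ s := by
      rw [show (1 - 16/17 : ℝ) = 17⁻¹ by norm_num, Real.inv_rpow (by norm_num)]; simp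
    rw [e2] at H2
    -- tail
    have T1 := (hasSum_nat_add_iff' N).2 H
    have T2 := (hasSum_nat_add_iff' N).2 H2
    have T3 := T2.mul_left ((15/16 : ℝ) ^ N)
    have tail : |1 / (t / (17/8)) ^ s - ∑ m ∈ Finset.range N, c m * u ^ m|
        ≤ (15/16 : ℝ) ^ N * 17 ^ s := by
      have A : |1 / (t / (17/8)) ^ s - ∑ m ∈ Finset.range N, c m * u ^ m| ≤
          (15/16 : ℝ) ^ N * (17 ^ s - ∑ m ∈ Finset.range N, c m * (16/17) ^ m) := by
        rw [← Real.norm_eq_abs, ← T1.tsum_eq]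
        refine tsum_of_norm_bounded T3 (fun i => ?_)
        rw [Real.norm_eq_abs, abs_mul, abs_of_nonneg (cnn _), abs_pow]
        have : |u| ^ (i + N) ≤ (15/16 : ℝ) ^ N * (16/17) ^ (i + N) := by
          calc |u| ^ (i + N) ≤ (15/17 : ℝ) ^ (i + N) := by gcongr
            _ = (15/16 : ℝ) ^ (i+N) * (16/17) ^ (i + N) := by rw [← mul_pow]; norm_num
            _ ≤ _ := by
              gcongr ?_ * _
              exact pow_le_pow_of_le_one (by norm_num) (by norm_num) (by omega)
        calc _ ≤ c (i + N) * ((15/16 : ℝ) ^ N * (16/17) ^ (i + N)) := by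
              have := cnn (i + N); gcongr
          _ = _ := by ring
      refine A.trans ?_
      have : 0 ≤ ∑ m ∈ Finset.range N, c m * (16/17 : ℝ) ^ m :=
        Finset.sum_nonneg fun m _ => mul_nonneg (cnn m) (by positivity)
      gcongr; linarith
    have ev : Polynomial.eval t (Polynomial.C ((17/8 : ℝ) ^ (-s)) * ∑ m ∈ Finset.range N,
        Polynomial.C (c m) * (1 - Polynomial.C (8/17) * Polynomial.X) ^ m) =
        (17/8 : ℝ) ^ (-s) * ∑ m ∈ Finset.range N, c m * u ^ m := by
      simp [Polynomial.eval_finsetSum, hu]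
    rw [ev]
    have p1 : 0 < (t / (17/8)) ^ s := by positivity
    have e3 : (17/8 : ℝ) ^ (-s) * t ^ s = (t / (17/8)) ^ s := by
      rw [Real.div_rpow htp.le (by norm_num), Real.rpow_neg (by norm_num)]; field_simp
    have e4 : (17/8 : ℝ) ^ (-s) * (∑ m ∈ Finset.range N, c m * u ^ m) * t ^ s - 1 =
        - ((t / (17/8)) ^ s * (1 / (t / (17/8)) ^ s - ∑ m ∈ Finset.range N, c m * u ^ m)) := by
      rw [mul_sub, mul_one_div_cancel p1.ne', ← e3]; ring
    rw [e4, abs_neg, abs_mul, abs_of_pos p1]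
    have b1 : (t / (17/8)) ^ s ≤ 2 ^ s := by
      apply Real.rpow_le_rpow (by positivity) _ hs.le; linarith
    calc _ ≤ (2 : ℝ) ^ s * ((15/16 : ℝ) ^ N * 17 ^ s) := by gcongr
      _ = (2 ^ s * 17 ^ s) * (15/16 : ℝ) ^ N := by ring
      _ = _ := by rw [← Real.mul_rpow (by norm_num) (by norm_num)]; norm_num

/-- parity homogenization -/
lemma homog_split (d k : ℕ) (p : MvPolynomial (Fin d) ℝ) (hp : p.totalDegree ≤ k) :
    ∃ P0 P1 : MvPolynomial (Fin d) ℝ, P0.IsHomogeneous k ∧ P1.IsHomogeneous (k + 1) ∧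
      ∀ v : Fin d → ℝ, ∑ i, v i ^ 2 = 1 →
        MvPolynomial.eval v p = MvPolynomial.eval v P0 + MvPolynomial.eval v P1 := by
  set R : MvPolynomial (Fin d) ℝ := ∑ i, MvPolynomial.X i ^ 2 with hR
  have hRh : R.IsHomogeneous 2 := by
    apply MvPolynomial.IsHomogeneous.sum
    intro i _
    exact MvPolynomial.isHomogeneous_X_pow i 2
  refine ⟨∑ j ∈ Finset.range (p.totalDegree + 1), if Even (k - j) then
      MvPolynomial.homogeneousComponent j p * R ^ ((k - j) / 2) else 0,
    ∑ j ∈ Finset.range (p.totalDegree + 1), if Even (k - j) then 0 else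
      MvPolynomial.homogeneousComponent j p * R ^ ((k + 1 - j) / 2), ?_, ?_, ?_⟩
  · apply MvPolynomial.IsHomogeneous.sum
    intro j hj
    have := Finset.mem_range.1 hj
    split_ifs with h
    · have h2 := (MvPolynomial.homogeneousComponent_isHomogeneous j p).mul (hRh.pow ((k - j) / 2))
      convert h2 using 1
      obtain ⟨r, hr⟩ := h
      omega
    · exact MvPolynomial.isHomogeneous_zero _ _ _
  · apply MvPolynomial.IsHomogeneous.sum
    intro j hj
    have := Finset.mem_range.1 hj
    split_ifs with h
    · exact MvPolynomial.isHomogeneous_zero _ _ _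
    · have h2 := (MvPolynomial.homogeneousComponent_isHomogeneous j p).mul
        (hRh.pow ((k + 1 - j) / 2))
      convert h2 using 1
      obtain ⟨r, hr⟩ := Nat.not_even_iff_odd.1 h
      omega
  · intro v hv
    have hRv : MvPolynomial.eval v R = 1 := by rw [hR]; simpa using hv
    conv_lhs => rw [← MvPolynomial.sum_homogeneousComponent p]
    rw [map_sum, map_sum, map_sum, ← Finset.sum_add_distrib]
    refine Finset.sum_congr rfl fun j _ => ?_
    split_ifs <;> simp [hRv]

lemma homog_eval (d k : ℕ) (P : MvPolynomial (Fin d) ℝ) (hP : P.IsHomogeneous k) (c : ℝ)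
    (v : Fin d → ℝ) : MvPolynomial.eval (fun i => c * v i) P = c ^ k * MvPolynomial.eval v P := by
  rw [MvPolynomial.eval_eq', MvPolynomial.eval_eq', Finset.mul_sum]
  refine Finset.sum_congr rfl fun m hm => ?_
  have : ∑ i, m i = k := by
    have := hP (MvPolynomial.mem_support_iff.1 hm)
    rw [← this, Finsupp.weight_apply, Finsupp.sum_fintype] <;> simp
  simp only [mul_pow, Finset.prod_mul_distrib]
  rw [Finset.prod_pow_eq_pow_sum, this]; ring

lemma memLp_of_bdd (d : ℕ) (hd : 3 ≤ d) (f : Ed d → ℝ)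
    (hf : AEStronglyMeasurable f (sphereMeasure d)) (M : ℝ) (hM : ∀ x ∈ sphereSet d, |f x| ≤ M) :
    MemLp f 2 (sphereMeasure d) := by
  have := sphereMeasure_finite d hd
  refine MemLp.of_bound hf M ?_
  filter_upwards [ae_restrict_mem (sphere_measurable d)] with x hx
  exact hM x hx

lemma J_mono (d : ℕ) (f g : Ed d → ℝ) (c : ℝ)
    (hf : AEStronglyMeasurable f (sphereMeasure d)) (hg : MemLp g 2 (sphereMeasure d))
    (h : ∀ x ∈ sphereSet d, |f x| ≤ c * |g x|) :
    MemLp f 2 (sphereMeasure d) ∧ J d f ≤ c ^ 2 * J d g := by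
  have hf2 : MemLp f 2 (sphereMeasure d) := by
    refine hg.of_le_mul (c := c) hf ?_
    filter_upwards [ae_restrict_mem (sphere_measurable d)] with x hx
    exact h x hx
  refine ⟨hf2, ?_⟩
  unfold J
  rw [← integral_const_mul]
  refine integral_mono_ae hf2.integrable_sq (hg.integrable_sq.const_mul _) ?_
  filter_upwards [ae_restrict_mem (sphere_measurable d)] with x hx
  have := h x hx
  calc f x ^ 2 = |f x| ^ 2 := (sq_abs _).symm
    _ ≤ (c * |g x|) ^ 2 := by gcongr
    _ = _ := by rw [mul_pow, sq_abs]

lemma J_add (d : ℕ) (f g : Ed d → ℝ) (hf : MemLp f 2 (sphereMeasure d))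
    (hg : MemLp g 2 (sphereMeasure d)) :
    J d (fun x => f x + g x) ≤ 2 * (J d f + J d g) := by
  unfold J
  rw [← integral_add hf.integrable_sq hg.integrable_sq, ← integral_const_mul]
  refine integral_mono (hf.add hg).integrable_sq
    ((hf.integrable_sq.add hg.integrable_sq).const_mul 2) fun x => ?_
  nlinarith [sq_nonneg (f x - g x)]

lemma J_nonneg (d : ℕ) (f : Ed d → ℝ) : 0 ≤ J d f := integral_nonneg fun _ => sq_nonneg _

lemma J_congr (d : ℕ) (f g : Ed d → ℝ) (h : ∀ x ∈ sphereSet d, f x = g x) : J d f = J d g := by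
  unfold J
  refine integral_congr_ae ?_
  filter_upwards [ae_restrict_mem (sphere_measurable d)] with x hx
  simp [h x hx]

lemma J_le_bdd (d : ℕ) (hd : 3 ≤ d) (f : Ed d → ℝ) (M : ℝ)
    (hM : ∀ x ∈ sphereSet d, |f x| ≤ M) :
    J d f ≤ M ^ 2 * (sphereMeasure d).real Set.univ := by
  have := sphereMeasure_finite d hd
  have e : M ^ 2 * (sphereMeasure d).real Set.univ = ∫ x, M ^ 2 ∂ sphereMeasure d := by
    simp [mul_comm]
  rw [e]
  refine integral_mono_of_nonneg (ae_of_all _ fun x => sq_nonneg _) (integrable_const _) ?_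
  filter_upwards [ae_restrict_mem (sphere_measurable d)] with x hx
  have := hM x hx
  rw [← sq_abs]
  gcongr

def pev (d : ℕ) (p : MvPolynomial (Fin d) ℝ) (x : Ed d) : ℝ := MvPolynomial.eval (fun i => x i) p

lemma pev_cont (d : ℕ) (p : MvPolynomial (Fin d) ℝ) : Continuous (pev d p) := by
  unfold pev
  exact (MvPolynomial.continuous_eval p).comp (PiLp.continuous_ofLp 2 _)

lemma pev_memLp (d : ℕ) (hd : 3 ≤ d) (p : MvPolynomial (Fin d) ℝ) :
    MemLp (pev d p) 2 (sphereMeasure d) := by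
  obtain ⟨M, hM⟩ := (isCompact_sphere (0 : Ed d) 1).exists_bound_of_continuousOn
    (pev_cont d p).continuousOn
  exact memLp_of_bdd d hd _ (pev_cont d p).aestronglyMeasurable M hM

lemma weight_le (d : ℕ) (T : Ed d ≃L[ℝ] Ed d) (h2 : ‖(T.symm : Ed d →L[ℝ] Ed d)‖ ≤ 2)
    (x : Ed d) (hx : x ∈ sphereSet d) : ‖T x‖ ^ (-((d : ℝ) + 1)) ≤ 2 ^ (d + 1) := by
  have hx1 : ‖x‖ = 1 := by simpa [sphereSet] using hx
  have := half_le d T h2 x hx1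
  have h := Real.rpow_le_rpow_of_nonpos (z := -((d : ℝ) + 1)) (by norm_num) this
    (by have : (0:ℝ) ≤ d := by positivity
        linarith)
  refine h.trans (le_of_eq ?_)
  rw [one_div, Real.inv_rpow (by norm_num), Real.rpow_neg (by norm_num), inv_inv]
  exact_mod_cast Real.rpow_natCast 2 (d + 1)

lemma weight_meas (d : ℕ) (T : Ed d ≃L[ℝ] Ed d) (r : ℝ) : Measurable (fun x => ‖T x‖ ^ r) :=
  T.continuous.measurable.norm.pow_const r

lemma Tact_J (d : ℕ) (hd : 3 ≤ d) (T : Ed d ≃L[ℝ] Ed d) (h1 : ‖(T : Ed d →L[ℝ] Ed d)‖ ≤ 2)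
    (h2 : ‖(T.symm : Ed d →L[ℝ] Ed d)‖ ≤ 2) (g : Ed d → ℝ) (hg : MemLp g 2 (sphereMeasure d)) :
    MemLp (Tact d T g) 2 (sphereMeasure d) ∧
    J d (Tact d T g) ≤ (2 ^ (d + 1)) ^ 2 * ((8 : ℝ) ^ ((d : ℝ) - 1) * J d g) := by
  obtain ⟨a1, a2⟩ := J_comp_le d hd T h1 h2 g hg
  have := J_mono d (Tact d T g) (fun x => g (nmap d T x)) (2 ^ (d + 1))
    (a1.aestronglyMeasurable.mul (weight_meas d T _).aestronglyMeasurable) a1 (by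
      intro x hx
      have h3 := weight_le d T h2 x hx
      have h4 : 0 ≤ ‖T x‖ ^ (-((d : ℝ) + 1)) := by positivity
      rw [Tact, abs_mul, abs_of_nonneg h4, mul_comm]
      unfold nmap
      gcongr)
  refine ⟨this.1, this.2.trans ?_⟩
  gcongr

lemma Tact_aesm (d : ℕ) (hd : 3 ≤ d) (T : Ed d ≃L[ℝ] Ed d) (h1 : ‖(T : Ed d →L[ℝ] Ed d)‖ ≤ 2)
    (h2 : ‖(T.symm : Ed d →L[ℝ] Ed d)‖ ≤ 2) (f : Ed d → ℝ)
    (hf : AEStronglyMeasurable (Tact d T f) (sphereMeasure d)) :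
    AEStronglyMeasurable f (sphereMeasure d) := by
  have q := nmap_qmp d hd T.symm h2 (by simpa using h1)
  have hf1 := hf.comp_quasiMeasurePreserving q
  have hf2 : AEStronglyMeasurable (fun y => ‖T (nmap d T.symm y)‖ ^ ((d : ℝ) + 1))
      (sphereMeasure d) :=
    ((weight_meas d T _).comp (nmap_meas d T.symm)).aestronglyMeasurable
  refine (hf1.mul hf2).congr ?_
  filter_upwards [ae_restrict_mem (sphere_measurable d)] with y hy
  have e := nmap_inv d T.symm y hy
  have hm := nmap_mem d T.symm y hy
  have hx1 : ‖nmap d T.symm y‖ = 1 := by simpa [sphereSet] using hm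
  have := half_le d T h2 _ hx1
  have hp : 0 < ‖T (nmap d T.symm y)‖ := by linarith
  have e' : ‖T (nmap d T.symm y)‖⁻¹ • T (nmap d T.symm y) = y := e
  simp only [Pi.mul_apply, Function.comp, Tact]
  rw [e', mul_assoc, ← Real.rpow_add hp]
  simp

/-- linear forms of `T` -/
def lform (d : ℕ) (T : Ed d ≃L[ℝ] Ed d) (i : Fin d) : MvPolynomial (Fin d) ℝ :=
  ∑ j, MvPolynomial.C (T (EuclideanSpace.single j 1) i) * MvPolynomial.X j

lemma lform_eval (d : ℕ) (T : Ed d ≃L[ℝ] Ed d) (i : Fin d) (x : Ed d) :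
    MvPolynomial.eval (fun i => x i) (lform d T i) = T x i := by
  have hx : x = ∑ j, x j • EuclideanSpace.single j (1 : ℝ) := by
    ext i
    simp [Finset.sum_apply, Pi.single_apply]
  conv_rhs => rw [hx]
  simp [lform, mul_comm]

lemma lform_homog (d : ℕ) (T : Ed d ≃L[ℝ] Ed d) (i : Fin d) : (lform d T i).IsHomogeneous 1 := by
  apply MvPolynomial.IsHomogeneous.sum
  intro j _
  exact MvPolynomial.isHomogeneous_C_mul_X _ j

lemma piece (d : ℕ) (T : Ed d ≃L[ℝ] Ed d) (h1 : ‖(T : Ed d →L[ℝ] Ed d)‖ ≤ 2)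
    (h2 : ‖(T.symm : Ed d →L[ℝ] Ed d)‖ ≤ 2) (j N : ℕ) (P : MvPolynomial (Fin d) ℝ)
    (hP : P.IsHomogeneous j) : ∃ q : MvPolynomial (Fin d) ℝ, q.totalDegree ≤ j + 2 * N ∧
      ∀ x ∈ sphereSet d, |Tact d T (pev d P) x - pev d q x| ≤
        (34 ^ (((j : ℝ) + d + 1) / 2) * (15/16 : ℝ) ^ N) * |Tact d T (pev d P) x| := by
  obtain ⟨Q, hQ, hQ2⟩ := approx (((j : ℝ) + d + 1) / 2) (by positivity) N
  set S : MvPolynomial (Fin d) ℝ := ∑ i, lform d T i ^ 2 with hS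
  have hSd : S.totalDegree ≤ 2 := by
    apply MvPolynomial.IsHomogeneous.totalDegree_le
    apply MvPolynomial.IsHomogeneous.sum
    intro i _
    exact (lform_homog d T i).pow 2
  have hSe : ∀ x : Ed d, MvPolynomial.eval (fun i => x i) S = ‖T x‖ ^ 2 := by
    intro x
    rw [hS, EuclideanSpace.norm_sq_eq]
    simp [lform_eval]
  refine ⟨MvPolynomial.aeval (lform d T) P * Polynomial.aeval S Q, ?_, ?_⟩
  · refine (MvPolynomial.totalDegree_mul _ _).trans ?_
    refine add_le_add ?_ ?_
    · have := (hP.aeval (lform d T) (lform_homog d T)).totalDegree_le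
      simpa using this
    · rw [Polynomial.aeval_eq_sum_range]
      refine MvPolynomial.totalDegree_finsetSum_le fun i hi => ?_
      refine (MvPolynomial.totalDegree_smul_le _ _).trans ?_
      refine (MvPolynomial.totalDegree_pow _ _).trans ?_
      have := Finset.mem_range.1 hi
      nlinarith
  · intro x hx
    have hx1 : ‖x‖ = 1 := by simpa [sphereSet] using hx
    have b1 := half_le d T h2 x hx1
    have b2 := le_two d T h1 x hx1
    have hp : 0 < ‖T x‖ := by linarith
    have e1 : pev d (MvPolynomial.aeval (lform d T) P * Polynomial.aeval S Q) x =
        pev d P (T x) * Q.eval (‖T x‖ ^ 2) := by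
      unfold pev
      rw [map_mul]
      congr 1
      · rw [← MvPolynomial.coe_aeval_eq_eval, RingHom.coe_coe]
        rw [← AlgHom.comp_apply, MvPolynomial.comp_aeval]
        have : (fun i => (MvPolynomial.aeval fun i => x i) (lform d T i)) = fun i => T x i := by
          funext i
          rw [← lform_eval]; rfl
        rw [this]; rfl
      · rw [← hSe x, Polynomial.aeval_def, Polynomial.hom_eval₂]
        rw [Polynomial.eval, ]
        congr 1
        ext; simp
    have e2 : pev d P (T x) = ‖T x‖ ^ j * pev d P (‖T x‖⁻¹ • T x) := by
      unfold pev
      rw [← homog_eval d j P hP]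
      congr 2
      funext i
      simp [mul_inv_cancel_left₀ hp.ne']
    have e3 : ‖T x‖ ^ (-((d : ℝ) + 1)) * (‖T x‖ ^ 2) ^ (((j : ℝ) + d + 1) / 2) = ‖T x‖ ^ j := by
      rw [← Real.rpow_natCast_mul hp.le, ← Real.rpow_add hp, ← Real.rpow_natCast]
      congr 1; push_cast; ring
    have e4 : Tact d T (pev d P) x -
        pev d (MvPolynomial.aeval (lform d T) P * Polynomial.aeval S Q) x =
        -((Q.eval (‖T x‖ ^ 2) * (‖T x‖ ^ 2) ^ (((j : ℝ) + d + 1) / 2) - 1) *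
          Tact d T (pev d P) x) := by
      rw [e1, e2, ← e3]; unfold Tact; ring
    rw [e4, abs_neg, abs_mul]
    gcongr
    apply hQ2
    constructor <;> nlinarith

lemma parts_J (d : ℕ) (hd : 3 ≤ d) (k : ℕ) (p P0 P1 : MvPolynomial (Fin d) ℝ)
    (h0 : P0.IsHomogeneous k) (h1 : P1.IsHomogeneous (k + 1))
    (h : ∀ x ∈ sphereSet d, pev d p x = pev d P0 x + pev d P1 x) :
    J d (pev d P0) ≤ (1 + 8 ^ ((d : ℝ) - 1)) * J d (pev d p) ∧
    J d (pev d P1) ≤ (1 + 8 ^ ((d : ℝ) - 1)) * J d (pev d p) := by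
  have hn : ∀ x ∈ sphereSet d, nmap d (ContinuousLinearEquiv.neg ℝ) x = -x := by
    intro x hx
    have hx1 : ‖x‖ = 1 := by simpa [sphereSet] using hx
    simp [nmap, hx1]
  have hneg : ‖((ContinuousLinearEquiv.neg ℝ : Ed d ≃L[ℝ] Ed d) : Ed d →L[ℝ] Ed d)‖ ≤ 2 :=
    ContinuousLinearMap.opNorm_le_bound _ (by norm_num) fun x => by
      simp; linarith [norm_nonneg x]
  obtain ⟨m1, m2⟩ := J_comp_le d hd (ContinuousLinearEquiv.neg ℝ) hneg
    (by simpa using hneg) (pev d p) (pev_memLp d hd p)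
  set g : Ed d → ℝ := fun x => pev d p (nmap d (ContinuousLinearEquiv.neg ℝ) x) with hg
  have ng : ∀ (j : ℕ) (P : MvPolynomial (Fin d) ℝ), P.IsHomogeneous j → ∀ x,
      pev d P (-x) = (-1) ^ j * pev d P x := by
    intro j P hP x
    unfold pev
    rw [← homog_eval d j P hP]
    congr 2; funext i; simp
  have key : ∀ x ∈ sphereSet d, g x = (-1) ^ k * (pev d P0 x - pev d P1 x) := by
    intro x hx
    rw [hg]; simp only
    rw [hn x hx, h (-x) (by simpa [sphereSet] using hx), ng k P0 h0, ng (k+1) P1 h1]; ring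
  have hp := pev_memLp d hd p
  have sg : ((-1 : ℝ) ^ k) * (-1) ^ k = 1 := by rw [← mul_pow]; simp
  have hb : ∀ (σ : ℝ), σ ^ 2 = 1 → J d (fun x => (pev d p x + σ * g x)) ≤
      4 * ((1 + 8 ^ ((d : ℝ) - 1)) * J d (pev d p)) := by
    intro σ hσ
    refine (J_add d (pev d p) (fun x => σ * g x) hp (m1.const_mul σ)).trans ?_
    have : J d (fun x => σ * g x) = J d g := by
      unfold J; simp [mul_pow, hσ]
    rw [this]
    nlinarith [J_nonneg d (pev d p), J_nonneg d g]
  have hsq : ∀ (P : MvPolynomial (Fin d) ℝ) (σ : ℝ), σ ^ 2 = 1 →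
      (∀ x ∈ sphereSet d, pev d p x + σ * g x = 2 * pev d P x) →
      J d (pev d P) ≤ (1 + 8 ^ ((d : ℝ) - 1)) * J d (pev d p) := by
    intro P σ hσ hP
    have a := hb σ hσ
    rw [J_congr d _ _ hP] at a
    have : J d (fun x => 2 * pev d P x) = 4 * J d (pev d P) := by
      unfold J; simp only [mul_pow]; rw [integral_const_mul]; norm_num
    rw [this] at a
    linarith
  constructor
  · apply hsq P0 ((-1) ^ k) (by rw [sq, sg])
    intro x hx
    rw [key x hx, ← mul_assoc, sg, h x hx]; ring
  · apply hsq P1 (-(-1) ^ k) (by rw [neg_sq, sq, sg])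
    intro x hx
    rw [key x hx, neg_mul, ← mul_assoc, sg, h x hx]; ring

lemma exp_decay (a : ℝ) : ∃ C : ℝ, 0 ≤ C ∧ ∀ k : ℕ, 0 < k →
    (1/2 : ℝ) ^ k ≤ C * (k : ℝ) ^ (-a) := by
  obtain ⟨B, hB⟩ := (tendsto_pow_const_mul_const_pow_of_lt_one ⌈a⌉₊ (r := 1/2)
    (by norm_num) (by norm_num)).bddAbove_range
  have hB' : ∀ n : ℕ, (n : ℝ) ^ ⌈a⌉₊ * (1/2) ^ n ≤ B := fun n => hB ⟨n, rfl⟩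
  refine ⟨B, le_trans (by positivity) (hB' 1), fun k hk => ?_⟩
  have hk1 : (1 : ℝ) ≤ k := by exact_mod_cast hk
  have hk0 : (0 : ℝ) < k := by linarith
  rw [Real.rpow_neg hk0.le, ← div_eq_mul_inv, le_div_iff₀ (by positivity)]
  refine le_trans ?_ (hB' k)
  rw [mul_comm]
  gcongr
  rw [← Real.rpow_natCast]
  exact Real.rpow_le_rpow_of_exponent_le hk1 (Nat.le_ceil a)

lemma eps_bound (d k j : ℕ) (hj : j ≤ k + 1) :
    (34 : ℝ) ^ (((j : ℝ) + d + 1) / 2) * (15/16 : ℝ) ^ (66 * (k + d + 2)) ≤ (1/2) ^ k := by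
  have a1 : (34 : ℝ) ^ (((j : ℝ) + d + 1) / 2) ≤ 34 ^ (k + d + 2) := by
    rw [← Real.rpow_natCast]
    apply Real.rpow_le_rpow_of_exponent_le (by norm_num)
    have : (j : ℝ) ≤ k + 1 := by exact_mod_cast hj
    push_cast
    have : (0 : ℝ) ≤ k := by positivity
    have : (0 : ℝ) ≤ d := by positivity
    linarith
  have a2 : (15/16 : ℝ) ^ 66 ≤ 1/68 := by norm_num
  calc _ ≤ (34 : ℝ) ^ (k + d + 2) * (1/68) ^ (k + d + 2) := by
        rw [pow_mul]; gcongr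
    _ = (1/2) ^ (k + d + 2) := by rw [← mul_pow]; norm_num
    _ ≤ _ := pow_le_pow_of_le_one (by norm_num) (by norm_num) (by omega)

lemma L2_lt (d : ℕ) (f : Ed d → ℝ) (c : ℝ) (h : L2norm d f < c) : J d f ≤ c ^ 2 := by
  have h0 : 0 ≤ L2norm d f := Real.sqrt_nonneg _
  have : L2norm d f ^ 2 = J d f := Real.sq_sqrt (J_nonneg d f)
  rw [← this]
  gcongr

lemma core (d : ℕ) (hd : 3 ≤ d) (a : ℝ) (ha : 0 ≤ a) : ∃ C0 : ℝ, 0 ≤ C0 ∧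
    ∀ T : Ed d ≃L[ℝ] Ed d,
      ‖(T : Ed d →L[ℝ] Ed d)‖ ≤ 2 → ‖(T.symm : Ed d →L[ℝ] Ed d)‖ ≤ 2 →
      ∀ (f : Ed d → ℝ) (M : ℝ), 0 ≤ M → AEStronglyMeasurable f (sphereMeasure d) →
      (∀ x ∈ sphereSet d, |f x| ≤ M) → ∀ k : ℕ, 0 < k → ∀ p : MvPolynomial (Fin d) ℝ,
      p.totalDegree ≤ k → J d (fun x => f x - pev d p x) ≤ (M * (k : ℝ) ^ (-a)) ^ 2 →
      ∃ q : MvPolynomial (Fin d) ℝ, q.totalDegree ≤ (134 + 132 * (d + 2)) * k ∧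
        J d (fun x => Tact d T f x - pev d q x) ≤ C0 * (M * (k : ℝ) ^ (-a)) ^ 2 := by
  obtain ⟨Ca, hCa, hdec⟩ := exp_decay a
  set K : ℝ := 8 ^ ((d : ℝ) - 1) with hK
  have hK0 : 0 ≤ K := by positivity
  set W : ℝ := (2 ^ (d + 1)) ^ 2 with hW
  have hW0 : 0 ≤ W := by positivity
  set V : ℝ := (sphereMeasure d).real Set.univ with hV
  have hV0 : 0 ≤ V := measureReal_nonneg
  refine ⟨2 * (W * K + 4 * (Ca ^ 2 * (W * K * ((1 + K) * (2 * (V + 1)))))), by positivity, ?_⟩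
  intro T h1 h2 f M hM hf hfM k hk p hp hJ
  obtain ⟨P0, P1, hP0, hP1, hsum⟩ := homog_split d k p hp
  have hsum' : ∀ x ∈ sphereSet d, pev d p x = pev d P0 x + pev d P1 x := by
    intro x hx
    have hx1 : ‖x‖ = 1 := by simpa [sphereSet] using hx
    apply hsum
    have := EuclideanSpace.real_norm_sq_eq x
    rw [← this, hx1]; norm_num
  obtain ⟨J0, J1⟩ := parts_J d hd k p P0 P1 hP0 hP1 hsum'
  obtain ⟨q0, hq0, hq0'⟩ := piece d T h1 h2 k (66 * (k + d + 2)) P0 hP0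
  obtain ⟨q1, hq1, hq1'⟩ := piece d T h1 h2 (k + 1) (66 * (k + d + 2)) P1 hP1
  have mf := memLp_of_bdd d hd f hf M hfM
  have mp := pev_memLp d hd p
  have mg : MemLp (fun x => f x - pev d p x) 2 (sphereMeasure d) := mf.sub mp
  have hk1 : (1 : ℝ) ≤ k := by exact_mod_cast hk
  set κ : ℝ := (k : ℝ) ^ (-a) with hκ
  have hκ0 : 0 < κ := by positivity
  have hκ1 : κ ≤ 1 := Real.rpow_le_one_of_one_le_of_nonpos hk1 (by linarith)
  -- bound on J p
  have Jp : J d (pev d p) ≤ 2 * (V + 1) * M ^ 2 := by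
    have e : J d (pev d p) = J d (fun x => f x + -(f x - pev d p x)) :=
      J_congr d _ _ fun x _ => by ring
    have b := J_add d f (fun x => -(f x - pev d p x)) mf mg.neg
    have e2 : J d (fun x => -(f x - pev d p x)) = J d (fun x => f x - pev d p x) := by
      unfold J; simp only [neg_sq]
    rw [e2] at b
    have b3 := J_le_bdd d hd f M hfM
    have b4 : (M * κ) ^ 2 ≤ M ^ 2 := by
      rw [mul_pow]
      have : κ ^ 2 ≤ 1 := pow_le_one₀ hκ0.le hκ1
      nlinarith [sq_nonneg M]
    rw [e]
    nlinarith
  have pieceJ : ∀ (j : ℕ) (P q : MvPolynomial (Fin d) ℝ), j ≤ k + 1 →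
      J d (pev d P) ≤ (1 + K) * J d (pev d p) →
      (∀ x ∈ sphereSet d, |Tact d T (pev d P) x - pev d q x| ≤
        (34 ^ (((j : ℝ) + d + 1) / 2) * (15/16 : ℝ) ^ (66 * (k + d + 2))) *
          |Tact d T (pev d P) x|) →
      MemLp (fun x => Tact d T (pev d P) x - pev d q x) 2 (sphereMeasure d) ∧
      J d (fun x => Tact d T (pev d P) x - pev d q x) ≤
        Ca ^ 2 * (W * K * ((1 + K) * (2 * (V + 1)))) * (M * κ) ^ 2 := by
    intro j P q hj hJP hq
    obtain ⟨t1, t2⟩ := Tact_J d hd T h1 h2 (pev d P) (pev_memLp d hd P)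
    obtain ⟨r1, r2⟩ := J_mono d (fun x => Tact d T (pev d P) x - pev d q x)
      (Tact d T (pev d P)) (Ca * κ)
      (t1.aestronglyMeasurable.sub (pev_cont d q).aestronglyMeasurable) t1 (by
        intro x hx
        refine (hq x hx).trans ?_
        exact mul_le_mul_of_nonneg_right ((eps_bound d k j hj).trans (hdec k hk)) (abs_nonneg _))
    refine ⟨r1, r2.trans ?_⟩
    calc (Ca * κ) ^ 2 * J d (Tact d T (pev d P))
        ≤ (Ca * κ) ^ 2 * (W * (K * ((1 + K) * (2 * (V + 1) * M ^ 2)))) := by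
          gcongr
          refine t2.trans ?_
          gcongr
          refine hJP.trans ?_
          gcongr
      _ = _ := by ring
  obtain ⟨r0, r0'⟩ := pieceJ k P0 q0 (by omega) J0 hq0'
  obtain ⟨r1, r1'⟩ := pieceJ (k + 1) P1 q1 le_rfl J1 hq1'
  obtain ⟨t1, t2⟩ := Tact_J d hd T h1 h2 _ mg
  refine ⟨q0 + q1, ?_, ?_⟩
  · refine (MvPolynomial.totalDegree_add _ _).trans ?_
    apply max_le
    · refine hq0.trans ?_
      nlinarith
    · refine hq1.trans ?_
      nlinarith
  · have e : J d (fun x => Tact d T f x - pev d (q0 + q1) x) =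
        J d (fun x => Tact d T (fun x => f x - pev d p x) x +
          ((Tact d T (pev d P0) x - pev d q0 x) + (Tact d T (pev d P1) x - pev d q1 x))) := by
      refine J_congr d _ _ fun x hx => ?_
      have := hsum' _ (nmap_mem d T x hx)
      have e3 : pev d (q0 + q1) x = pev d q0 x + pev d q1 x := by simp [pev]
      unfold nmap at this
      simp only [Tact]
      rw [e3, this]; ring
    rw [e]
    have c1 := J_add d _ _ t1 (r0.add r1)
    have c2 := J_add d _ _ r0 r1
    simp only [Pi.add_apply] at c1
    have c3 : J d (Tact d T (fun x => f x - pev d p x)) ≤ W * K * (M * κ) ^ 2 := by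
      refine t2.trans ?_
      rw [mul_assoc]
      gcongr
    have c1' : J d (fun x => Tact d T (fun x => f x - pev d p x) x +
          ((Tact d T (pev d P0) x - pev d q0 x) + (Tact d T (pev d P1) x - pev d q1 x))) ≤
        2 * (J d (Tact d T (fun x => f x - pev d p x)) + J d (fun x =>
          ((Tact d T (pev d P0) x - pev d q0 x) + (Tact d T (pev d P1) x - pev d q1 x)))) := c1
    linarith

lemma L2_of_not_aesm (d : ℕ) (F : Ed d → ℝ) (hF : ¬ AEStronglyMeasurable F (sphereMeasure d)) :
    ∃ c : ℝ, L2norm d (fun x => F x - c) = 0 := by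
  by_contra hcon
  push Not at hcon
  have key : ∀ c : ℝ, AEStronglyMeasurable (fun x => (F x - c) ^ 2) (sphereMeasure d) := by
    intro c
    by_contra h
    apply hcon c
    unfold L2norm
    rw [integral_undef (fun hi => h hi.aestronglyMeasurable)]
    simp
  apply hF
  have := ((((key 0).sub (key 1)).add_const 1).const_mul (1/2))
  refine this.congr (ae_of_all _ fun x => ?_)
  simp; ring

lemma abs_le_supNorm (d : ℕ) (f : Ed d → ℝ) (h : BddAbove ((fun x => |f x|) '' sphereSet d))
    (x : Ed d) (hx : x ∈ sphereSet d) : |f x| ≤ supNorm d f := le_csSup h ⟨x, hx, rfl⟩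

lemma main_set (d : ℕ) (hd : 3 ≤ d) (a : ℝ) (ha : 0 ≤ a) (δ : ℝ) (hδ : 0 < δ) :
    ∃ C : ℝ, 0 < C ∧ ∀ T : Ed d ≃L[ℝ] Ed d,
        ‖(T : Ed d →L[ℝ] Ed d)‖ ≤ 2 → ‖(T.symm : Ed d →L[ℝ] Ed d)‖ ≤ 2 →
        ∀ f : Ed d → ℝ, ∀ M ∈ UaSet d a f, C * M ∈ UaSet d (a - δ) (Tact d T f) := by
  obtain ⟨C0, hC0, hcore⟩ := core d hd a ha
  revert hcore
  generalize hA : 134 + 132 * (d + 2) = A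
  intro hcore
  set V : ℝ := (sphereMeasure d).real Set.univ with hV
  have hV0 : 0 ≤ V := measureReal_nonneg
  have hA0 : (0 : ℝ) < A := by rw [← hA]; positivity
  have hAn : 0 < A := by omega
  set B1 : ℝ := Real.sqrt C0 * (2 * A) ^ a with hB1
  set B2 : ℝ := Real.sqrt ((2 ^ (d + 1)) ^ 2 * V) * A ^ a with hB2
  have hB1' : 0 ≤ B1 := by positivity
  have hB2' : 0 ≤ B2 := by positivity
  refine ⟨2 ^ (d + 1) + B1 + B2, by positivity, ?_⟩
  rintro T h1 h2 f M ⟨hM, hbdd, hsup, hpoly⟩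
  have hfs := abs_le_supNorm d f hbdd
  have hfM : ∀ x ∈ sphereSet d, |f x| ≤ M := fun x hx => (hfs x hx).trans hsup.le
  have hs0 : 0 ≤ supNorm d f := Real.sSup_nonneg (by rintro _ ⟨x, _, rfl⟩; exact abs_nonneg _)
  have hT : ∀ x ∈ sphereSet d, |Tact d T f x| ≤ 2 ^ (d + 1) * supNorm d f := by
    intro x hx
    have h3 := weight_le d T h2 x hx
    have h4 : 0 ≤ ‖T x‖ ^ (-((d : ℝ) + 1)) := by positivity
    have h5 := hfs _ (nmap_mem d T x hx)
    unfold nmap at h5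
    rw [Tact, abs_mul, abs_of_nonneg h4, mul_comm]
    gcongr
  refine ⟨by positivity, ⟨_, by rintro _ ⟨x, hx, rfl⟩; exact hT x hx⟩, ?_, ?_⟩
  · calc supNorm d (Tact d T f) ≤ 2 ^ (d + 1) * supNorm d f :=
        Real.sSup_le (by rintro _ ⟨x, hx, rfl⟩; exact hT x hx) (by positivity)
      _ < 2 ^ (d + 1) * M := by gcongr
      _ ≤ _ := by gcongr; linarith
  · intro n hn
    have hn1 : (1 : ℝ) ≤ n := by exact_mod_cast hn
    have hn0 : (0 : ℝ) < n := by linarith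
    have hpos : 0 < (2 ^ (d + 1) + B1 + B2) * M * (n : ℝ) ^ (-(a - δ)) := by positivity
    have hna : (n : ℝ) ^ (-a) ≤ (n : ℝ) ^ (-(a - δ)) :=
      Real.rpow_le_rpow_of_exponent_le hn1 (by linarith)
    have fin : ∀ B : ℝ, B < 2 ^ (d + 1) + B1 + B2 → B * M * (n : ℝ) ^ (-a) <
        (2 ^ (d + 1) + B1 + B2) * M * (n : ℝ) ^ (-(a - δ)) := by
      intro B hB
      calc B * M * (n : ℝ) ^ (-a) < (2 ^ (d + 1) + B1 + B2) * M * (n : ℝ) ^ (-a) := by gcongr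
        _ ≤ _ := by gcongr
    by_cases hF : AEStronglyMeasurable (Tact d T f) (sphereMeasure d)
    swap
    · obtain ⟨c, hc⟩ := L2_of_not_aesm d _ hF
      refine ⟨MvPolynomial.C c, by simp, ?_⟩
      simp only [MvPolynomial.eval_C, hc]
      exact hpos
    have hf := Tact_aesm d hd T h1 h2 f hF
    have two : (0 : ℝ) < 2 ^ (d + 1) := by positivity
    by_cases hnA : n < A
    · refine ⟨0, by simp, ?_⟩
      simp only [map_zero, sub_zero]
      refine lt_of_le_of_lt ?_ (fin B2 (by linarith))
      have b := J_le_bdd d hd (Tact d T f) (2 ^ (d + 1) * M) (fun x hx => (hT x hx).trans (by gcongr))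
      have e : L2norm d (Tact d T f) ≤ Real.sqrt ((2 ^ (d + 1)) ^ 2 * V) * M := by
        unfold L2norm
        rw [Real.sqrt_le_left (by positivity), mul_pow, Real.sq_sqrt (by positivity)]
        refine b.trans (le_of_eq ?_)
        ring
      refine e.trans ?_
      have : 1 ≤ (A : ℝ) ^ a * (n : ℝ) ^ (-a) := by
        rw [Real.rpow_neg hn0.le, ← div_eq_mul_inv, one_le_div (by positivity)]
        have : (n : ℝ) ≤ A := by exact_mod_cast hnA.le
        gcongr
      calc _ = Real.sqrt ((2 ^ (d + 1)) ^ 2 * V) * M * 1 := by ring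
        _ ≤ Real.sqrt ((2 ^ (d + 1)) ^ 2 * V) * M * ((A : ℝ) ^ a * (n : ℝ) ^ (-a)) := by gcongr
        _ = _ := by rw [hB2]; ring
    · push Not at hnA
      set k := n / A with hk
      have hk0 : 0 < k := Nat.div_pos hnA hAn
      obtain ⟨p, hp, hp2⟩ := hpoly k hk0
      obtain ⟨q, hq, hq2⟩ := hcore T h1 h2 f M hM.le hf hfM k hk0 p hp (L2_lt d _ _ hp2)
      refine ⟨q, hq.trans (Nat.mul_div_le n A), ?_⟩
      refine lt_of_le_of_lt ?_ (fin B1 (by linarith))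
      have hk0' : (0 : ℝ) < k := by exact_mod_cast hk0
      have e : L2norm d (fun x => Tact d T f x - MvPolynomial.eval (fun i => x i) q) ≤
          Real.sqrt C0 * (M * (k : ℝ) ^ (-a)) := by
        unfold L2norm
        rw [Real.sqrt_le_left (by positivity), mul_pow (Real.sqrt C0), Real.sq_sqrt hC0]
        exact hq2
      refine e.trans ?_
      have hnk : (n : ℝ) ≤ 2 * A * k := by
        have h6 := Nat.lt_mul_div_succ n hAn
        have : n ≤ 2 * A * k := by
          rw [← hk] at h6
          clear_value k
          nlinarith
        exact_mod_cast this
      have : (k : ℝ) ^ (-a) ≤ (2 * A) ^ a * (n : ℝ) ^ (-a) := by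
        rw [Real.rpow_neg hn0.le, Real.rpow_neg hk0'.le, ← div_eq_mul_inv,
          le_div_iff₀ (by positivity), inv_mul_le_iff₀ (by positivity),
          ← Real.mul_rpow (by positivity) (by positivity)]
        gcongr
        linarith
      calc _ ≤ Real.sqrt C0 * (M * ((2 * A) ^ a * (n : ℝ) ^ (-a))) := by gcongr
        _ = _ := by rw [hB1]; ring

/-- **Lemma 2.4 (ii).** For `T ∈ GL(d)` with `‖T‖, ‖T⁻¹‖ ≤ 2` and every `δ > 0` there is
`C_δ > 0` (depending only on `d, a, δ`) with `‖Tf‖_{U_{a-δ}} ≤ C_δ ‖f‖_{U_a}` for `f ∈ U_a`. -/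
theorem Tact_Ua_bound (d : ℕ) (hd : 3 ≤ d) (a : ℝ) (ha : 0 ≤ a) :
    ∀ δ : ℝ, 0 < δ → ∃ C : ℝ, 0 < C ∧
      ∀ T : Ed d ≃L[ℝ] Ed d,
        ‖(T : Ed d →L[ℝ] Ed d)‖ ≤ 2 → ‖(T.symm : Ed d →L[ℝ] Ed d)‖ ≤ 2 →
        ∀ f : Ed d → ℝ, MemUa d a f →
          MemUa d (a - δ) (Tact d T f) ∧ UaNorm d (a - δ) (Tact d T f) ≤ C * UaNorm d a f := by
  intro δ hδ
  obtain ⟨C, hC, h⟩ := main_set d hd a ha δ hδ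
  refine ⟨C, hC, fun T h1 h2 f hf => ?_⟩
  have key := h T h1 h2 f
  obtain ⟨M, hM⟩ := hf
  refine ⟨⟨_, key M hM⟩, ?_⟩
  unfold UaNorm
  rw [mul_comm, ← div_le_iff₀ hC]
  refine le_csInf ⟨M, hM⟩ fun M' hM' => ?_
  rw [div_le_iff₀ hC, mul_comm]
  exact csInf_le ⟨0, fun y hy => hy.1.le⟩ (key M' hM')


end
end

section
/- For every continuous function g : S^{d-1} → ℝ and every x ∈ S^{d-1}, Q(g, 1[d-2])(x) = R(g)(x); that is, the Q-transform with one argument equal to g and the remaining d−2 arguments equal to the constant function 1 coincides with the normalized Radon transform of g. -/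
open MeasureTheory Metric Filter Topology
open scoped Pointwise ENNReal

noncomputable section

theorem aux_normalize_lip {E : Type*} [NormedAddCommGroup E] [NormedSpace ℝ E] :
    LipschitzOnWith 2 (fun x : E => ‖x‖⁻¹ • x) {x | 1 ≤ ‖x‖} := by
  apply LipschitzOnWith.of_dist_le_mul
  intro x hx y hy
  simp only [Set.mem_ofPred_eq] at hx hy
  have hx0 : 0 < ‖x‖ := by linarith
  have hy0 : 0 < ‖y‖ := by linarith
  have e : ‖x‖⁻¹ • x - ‖y‖⁻¹ • y = ‖x‖⁻¹ • (x - y) + (‖x‖⁻¹ - ‖y‖⁻¹) • y := by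
    module
  have h1 : ‖‖x‖⁻¹ • (x - y)‖ ≤ ‖x - y‖ := by
    rw [norm_smul, norm_inv, norm_norm]
    exact mul_le_of_le_one_left (norm_nonneg _) (inv_le_one_of_one_le₀ hx)
  have h2 : ‖(‖x‖⁻¹ - ‖y‖⁻¹) • y‖ ≤ ‖x - y‖ := by
    have : ‖x‖⁻¹ - ‖y‖⁻¹ = (‖y‖ - ‖x‖) * ‖x‖⁻¹ * ‖y‖⁻¹ := by field_simp
    rw [norm_smul, this, norm_mul, norm_mul, norm_inv, norm_inv, norm_norm, norm_norm, mul_assoc,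
      inv_mul_cancel₀ hy0.ne', mul_one]
    calc ‖‖y‖ - ‖x‖‖ * ‖x‖⁻¹ ≤ ‖‖y‖ - ‖x‖‖ :=
          mul_le_of_le_one_right (norm_nonneg _) (inv_le_one_of_one_le₀ hx)
      _ ≤ ‖y - x‖ := by simpa using abs_norm_sub_norm_le y x
      _ = ‖x - y‖ := norm_sub_rev _ _
  rw [dist_eq_norm, dist_eq_norm, e]
  calc _ ≤ _ := norm_add_le _ _
    _ ≤ _ := by simp; linarith

theorem aux_sphere_finite (n : ℕ) :
    μH[(n : ℝ)] (Metric.sphere (0 : EuclideanSpace ℝ (Fin (n + 1))) 1) < ∞ := by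
  let J : Fin (n + 1) → ℝ → (Fin n → ℝ) → EuclideanSpace ℝ (Fin (n + 1)) :=
    fun i s w => WithLp.toLp 2 (Fin.insertNth i s w : Fin (n + 1) → ℝ)
  let N : EuclideanSpace ℝ (Fin (n + 1)) → EuclideanSpace ℝ (Fin (n + 1)) := fun x => ‖x‖⁻¹ • x
  have hJ : ∀ i s, ∃ K, LipschitzWith K (J i s) := by
    intro i s
    refine ⟨_, (PiLp.lipschitzWith_toLp 2 (fun _ : Fin (n + 1) => ℝ)).comp (Kg := 1)
      (g := fun w => (Fin.insertNth i s w : Fin (n + 1) → ℝ)) ?_⟩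
    apply LipschitzWith.of_dist_le_mul
    intro v w
    simp only [NNReal.coe_one, one_mul]
    rw [dist_pi_le_iff dist_nonneg]
    intro k
    refine Fin.succAboveCases i ?_ ?_ k
    · simp
    · intro j
      simpa using dist_le_pi_dist v w j
  have hfin : ∀ i s, |s| = 1 → μH[(n : ℝ)] ((N ∘ J i s) '' Metric.closedBall 0 1) < ∞ := by
    intro i s hs
    obtain ⟨K, hK⟩ := hJ i s
    have hm : Set.MapsTo (J i s) (Metric.closedBall 0 1) {x | 1 ≤ ‖x‖} := by
      intro w _
      have := PiLp.norm_apply_le (J i s w) i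
      simp only [J, Fin.insertNth_apply_same, Real.norm_eq_abs, hs] at this
      exact this
    have hL := (aux_normalize_lip (E := EuclideanSpace ℝ (Fin (n + 1)))).comp
      (hK.lipschitzOnWith (s := Metric.closedBall 0 1)) hm
    refine (hL.hausdorffMeasure_image_le (d := (n : ℝ)) (by positivity)).trans_lt ?_
    have h1 : (μH[(n : ℝ)] : Measure (Fin n → ℝ)) = volume := by
      have := hausdorffMeasure_pi_real (ι := Fin n)
      simpa using this
    rw [h1]
    apply ENNReal.mul_lt_top
    · exact ENNReal.rpow_lt_top_of_nonneg (by positivity) ENNReal.coe_ne_top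
    · exact (isCompact_closedBall _ _).measure_lt_top
  have hsub : Metric.sphere (0 : EuclideanSpace ℝ (Fin (n + 1))) 1 ⊆
      ⋃ i : Fin (n + 1), (((N ∘ J i 1) '' Metric.closedBall 0 1) ∪
        ((N ∘ J i (-1)) '' Metric.closedBall 0 1)) := by
    intro y hy
    have hy1 : ‖y‖ = 1 := by simpa using hy
    obtain ⟨i, -, hi⟩ := Finset.exists_max_image (Finset.univ : Finset (Fin (n + 1)))
      (fun i => |y i|) ⟨0, Finset.mem_univ _⟩
    have hpos : 0 < |y i| := by
      rw [abs_pos]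
      intro h0
      have : y = 0 := by
        ext k
        have := hi k (Finset.mem_univ _)
        rw [h0, abs_zero] at this
        simpa using abs_eq_zero.1 (le_antisymm this (abs_nonneg _))
      rw [this, norm_zero] at hy1
      exact zero_ne_one hy1
    have key : ∀ s, s = |y i|⁻¹ * y i → y ∈ (N ∘ J i s) '' Metric.closedBall 0 1 := by
      intro s hs
      refine ⟨fun k => |y i|⁻¹ * y (i.succAbove k), ?_, ?_⟩
      · rw [mem_closedBall_zero_iff, pi_norm_le_iff_of_nonneg zero_le_one]
        intro k
        rw [Real.norm_eq_abs, abs_mul, abs_inv, abs_abs, inv_mul_le_iff₀ hpos, mul_one]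
        exact hi _ (Finset.mem_univ _)
      · have : J i s (fun k => |y i|⁻¹ * y (i.succAbove k)) = |y i|⁻¹ • y := by
          ext k
          refine Fin.succAboveCases i ?_ ?_ k
          · simp [J, hs]
          · intro j
            simp [J]
        simp only [Function.comp, this, N, norm_smul, hy1]
        rw [smul_smul]
        simp [hpos.ne']
    refine Set.mem_iUnion.2 ⟨i, ?_⟩
    rcases le_or_gt 0 (y i) with h | h
    · left
      apply key
      rw [abs_of_nonneg h] at hpos ⊢
      rw [inv_mul_cancel₀ hpos.ne']
    · right
      apply key
      rw [abs_of_neg h, inv_neg, neg_mul, inv_mul_cancel₀ h.ne]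
  refine (measure_mono hsub).trans_lt ((measure_iUnion_le _).trans_lt ?_)
  rw [tsum_fintype]
  refine ENNReal.sum_lt_top.2 fun i _ => (measure_union_le _ _).trans_lt ?_
  exact ENNReal.add_lt_top.2 ⟨hfin i 1 (by simp), hfin i (-1) (by simp)⟩

theorem aux_iterInt {α : Type*} [MeasurableSpace α] (μ : Measure α) {S : Type*} [Fintype S] :
    ∀ (n : ℕ) (a : S → ℝ) (f : S → Fin n → α → ℝ), (∀ s k, Integrable (f s k) μ) →
      iterInt n μ (fun v => ∑ s, a s * ∏ k, f s k (v k)) = ∑ s, a s * ∏ k, ∫ t, f s k t ∂μ := by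
  intro n
  induction n with
  | zero => intro a f _; simp [iterInt]
  | succ n ih =>
    intro a f hf
    simp only [iterInt, Fin.prod_univ_succ, Fin.cons_zero, Fin.cons_succ, ← mul_assoc]
    have : ∀ t, iterInt n μ (fun v => ∑ s, a s * f s 0 t * ∏ k : Fin n, f s k.succ (v k))
        = ∑ s, a s * f s 0 t * ∏ k : Fin n, ∫ t, f s k.succ t ∂μ :=
      fun t => ih (fun s => a s * f s 0 t) (fun s k => f s k.succ) (fun s k => hf s _)
    simp only [this]
    rw [integral_finsetSum]
    · refine Finset.sum_congr rfl fun s _ => ?_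
      rw [integral_mul_const, integral_const_mul]
    · intro s _
      exact ((hf s 0).const_mul _).mul_const _

theorem aux_subSphere_univ (n : ℕ) (hn : 1 ≤ n) (x : Ed (n + 1)) (hx : ‖x‖ = 1) :
    subSphere (n + 1) x Set.univ = μH[(n : ℝ) - 1] (Metric.sphere (0 : EuclideanSpace ℝ (Fin n)) 1)
    := by
  have hx0 : x ≠ 0 := by intro h; simp [h] at hx
  have : Fact (Module.finrank ℝ (Ed (n + 1)) = n + 1) := ⟨by simp⟩
  let B := OrthonormalBasis.fromOrthogonalSpanSingleton (𝕜 := ℝ) n hx0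
  let φ : EuclideanSpace ℝ (Fin n) →ₗᵢ[ℝ] Ed (n + 1) :=
    (Submodule.subtypeₗᵢ (ℝ ∙ x)ᗮ).comp B.repr.symm.toLinearIsometry
  have him : φ '' (Metric.sphere 0 1) = sphereSet (n + 1) ∩ {y | (inner ℝ x y : ℝ) = 0} := by
    ext y
    simp only [sphereSet, Set.mem_image, mem_sphere_zero_iff_norm, Set.mem_inter_iff,
      Set.mem_ofPred_eq]
    constructor
    · rintro ⟨w, hw, rfl⟩
      refine ⟨by rw [φ.norm_map, hw], ?_⟩
      exact Submodule.mem_orthogonal_singleton_iff_inner_right.1 (B.repr.symm w).2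
    · rintro ⟨h1, h2⟩
      have hy : y ∈ (ℝ ∙ x)ᗮ := Submodule.mem_orthogonal_singleton_iff_inner_right.2 h2
      have e : φ (B.repr ⟨y, hy⟩) = y := by simp [φ]
      exact ⟨B.repr ⟨y, hy⟩, by rw [← φ.norm_map, e, h1], e⟩
  have h0 : (0 : ℝ) ≤ (n : ℝ) - 1 := by
    have : (1 : ℝ) ≤ n := by exact_mod_cast hn
    linarith
  rw [subSphere, Measure.restrict_apply_univ, ← him]
  have e : (((n + 1 : ℕ) : ℝ) - 2) = (n : ℝ) - 1 := by push_cast; ring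
  rw [e, φ.isometry.hausdorffMeasure_image (Or.inl h0)]

theorem aux_subSphere_finite (n : ℕ) (hn : 1 ≤ n) (x : Ed (n + 1)) (hx : ‖x‖ = 1) :
    IsFiniteMeasure (subSphere (n + 1) x) := by
  constructor
  rw [aux_subSphere_univ n hn x hx]
  obtain ⟨m, rfl⟩ : ∃ m, n = m + 1 := ⟨n - 1, by omega⟩
  have := aux_sphere_finite m
  simpa using this

theorem aux_meas (d : ℕ) (x : Ed d) :
    MeasurableSet (sphereSet d ∩ {y : Ed d | (inner ℝ x y : ℝ) = 0}) := by
  apply IsClosed.measurableSet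
  apply IsClosed.inter
  · exact Metric.isClosed_sphere
  · exact isClosed_eq (by fun_prop) continuous_const

theorem aux_integrable (d : ℕ) (x : Ed d) [IsFiniteMeasure (subSphere d x)] (f : Ed d → ℝ)
    (hf : Continuous f) : Integrable f (subSphere d x) := by
  obtain ⟨C, hC⟩ := (isCompact_sphere (0 : Ed d) 1).exists_bound_of_continuousOn hf.continuousOn
  refine Integrable.of_bound hf.aestronglyMeasurable C ?_
  filter_upwards [ae_restrict_mem (aux_meas d x)] with y hy
  exact hC y hy.1

theorem aux_invariant (d : ℕ) (x : Ed d) (T : Ed d ≃ₗᵢ[ℝ] Ed d) (hT : T x = x) (f : Ed d → ℝ) :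
    ∫ t, f (T t) ∂ subSphere d x = ∫ t, f t ∂ subSphere d x := by
  have hp : T ⁻¹' (sphereSet d ∩ {y : Ed d | (inner ℝ x y : ℝ) = 0}) =
      sphereSet d ∩ {y : Ed d | (inner ℝ x y : ℝ) = 0} := by
    ext y
    have : (inner ℝ x (T y) : ℝ) = inner ℝ x y := by
      conv_lhs => rw [← hT]
      exact T.inner_map_map x y
    simp [sphereSet, this]
  have hmp : MeasurePreserving T (μH[(d : ℝ) - 2]) (μH[(d : ℝ) - 2]) :=
    T.toIsometryEquiv.measurePreserving_hausdorffMeasure _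
  have := hmp.setIntegral_preimage_emb T.toHomeomorph.measurableEmbedding f
    (sphereSet d ∩ {y : Ed d | (inner ℝ x y : ℝ) = 0})
  rw [hp] at this
  exact this

theorem aux_basis (n : ℕ) (x : Ed (n + 1)) (hx : ‖x‖ = 1) :
    ∃ b : OrthonormalBasis (Fin (n + 1)) ℝ (Ed (n + 1)), b (Fin.last n) = x := by
  have ho : Orthonormal ℝ (({Fin.last n} : Set (Fin (n + 1))).domRestrict
      (fun _ : Fin (n + 1) => x)) := by
    constructor
    · intro i; exact hx
    · intro i j hij
      exact absurd (Subsingleton.elim i j) hij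
  obtain ⟨b, hb⟩ := ho.exists_orthonormalBasis_extension_of_card_eq (by simp)
  exact ⟨b, hb _ rfl⟩

theorem aux_offdiag (n : ℕ) (b : OrthonormalBasis (Fin (n + 1)) ℝ (Ed (n + 1)))
    (i j : Fin (n + 1)) (hij : i ≠ j) (hi : i ≠ Fin.last n) :
    ∫ t, (inner ℝ (b i) t : ℝ) * inner ℝ (b j) t ∂ subSphere (n + 1) (b (Fin.last n)) = 0 := by
  let T := Submodule.reflection (ℝ ∙ (b i))ᗮ
  have hfix : ∀ k, i ≠ k → T (b k) = b k := by
    intro k hk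
    apply Submodule.reflection_mem_subspace_eq_self
    rw [Submodule.mem_orthogonal_singleton_iff_inner_right]
    exact b.orthonormal.2 hk
  have hneg : T (b i) = - b i := Submodule.reflection_orthogonalComplement_singleton_eq_neg _
  have h := aux_invariant (n + 1) (b (Fin.last n)) T (hfix _ hi)
    (fun t => (inner ℝ (b i) t : ℝ) * inner ℝ (b j) t)
  have e1 : ∀ t, (inner ℝ (b i) (T t) : ℝ) = - inner ℝ (b i) t := by
    intro t
    have := T.inner_map_map (b i) t
    rw [hneg, inner_neg_left] at this
    linarith
  have e2 : ∀ t, (inner ℝ (b j) (T t) : ℝ) = inner ℝ (b j) t := by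
    intro t
    have := T.inner_map_map (b j) t
    rwa [hfix _ hij] at this
  simp only [e1, e2, neg_mul, integral_neg] at h
  linarith

theorem aux_diag (n : ℕ) (b : OrthonormalBasis (Fin (n + 1)) ℝ (Ed (n + 1)))
    (i j : Fin (n + 1)) (hi : i ≠ Fin.last n) (hj : j ≠ Fin.last n) :
    ∫ t, (inner ℝ (b i) t : ℝ) * inner ℝ (b i) t ∂ subSphere (n + 1) (b (Fin.last n)) =
    ∫ t, (inner ℝ (b j) t : ℝ) * inner ℝ (b j) t ∂ subSphere (n + 1) (b (Fin.last n)) := by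
  let T := b.equiv b (Equiv.swap i j)
  have hT : ∀ k, T (b k) = b (Equiv.swap i j k) := fun k => by simp [T]
  have h := aux_invariant (n + 1) (b (Fin.last n)) T
    (by rw [hT, Equiv.swap_apply_of_ne_of_ne hi.symm hj.symm])
    (fun t => (inner ℝ (b j) t : ℝ) * inner ℝ (b j) t)
  have e1 : ∀ t, (inner ℝ (b j) (T t) : ℝ) = inner ℝ (b i) t := by
    intro t
    have := T.inner_map_map (b i) t
    rwa [hT, Equiv.swap_apply_left] at this
  simp only [e1] at h
  exact h

theorem aux_last (n : ℕ) (b : OrthonormalBasis (Fin (n + 1)) ℝ (Ed (n + 1))) (g : Ed (n + 1) → ℝ) :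
    ∫ t, (inner ℝ (b (Fin.last n)) t : ℝ) * inner ℝ (b (Fin.last n)) t * g t
      ∂ subSphere (n + 1) (b (Fin.last n)) = 0 := by
  apply integral_eq_zero_of_ae
  filter_upwards [ae_restrict_mem (aux_meas (n + 1) (b (Fin.last n)))] with y hy
  have : (inner ℝ (b (Fin.last n)) y : ℝ) = 0 := hy.2
  simp [this]

theorem aux_trace (n : ℕ) (b : OrthonormalBasis (Fin (n + 1)) ℝ (Ed (n + 1)))
    [IsFiniteMeasure (subSphere (n + 1) (b (Fin.last n)))]
    (g : Ed (n + 1) → ℝ) (hg : Continuous g) :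
    ∑ i, ∫ t, (inner ℝ (b i) t : ℝ) * inner ℝ (b i) t * g t
      ∂ subSphere (n + 1) (b (Fin.last n)) = ∫ t, g t ∂ subSphere (n + 1) (b (Fin.last n)) := by
  rw [← integral_finsetSum]
  · apply integral_congr_ae
    filter_upwards [ae_restrict_mem (aux_meas (n + 1) (b (Fin.last n)))] with y hy
    have hy1 : ‖y‖ = 1 := by simpa [sphereSet] using hy.1
    rw [← Finset.sum_mul]
    have := b.sum_sq_norm_inner_right y
    have h2 : ∑ i, (inner ℝ (b i) y : ℝ) * inner ℝ (b i) y = 1 := by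
      rw [hy1] at this
      simpa [sq] using this
    rw [h2, one_mul]
  · intro i _
    exact aux_integrable _ _ _ (by fun_prop)

theorem aux_const (n : ℕ) (hn : 1 ≤ n) (b : OrthonormalBasis (Fin (n + 1)) ℝ (Ed (n + 1)))
    (i : Fin (n + 1)) (hi : i ≠ Fin.last n) :
    ∫ t, (inner ℝ (b i) t : ℝ) * inner ℝ (b i) t ∂ subSphere (n + 1) (b (Fin.last n)) =
      sphVol n / n := by
  have hf := aux_subSphere_finite n hn (b (Fin.last n)) (b.orthonormal.1 _)
  have h := aux_trace n b (fun _ => 1) continuous_const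
  rw [Fin.sum_univ_castSucc, aux_last] at h
  simp only [mul_one, add_zero] at h
  rw [Finset.sum_congr rfl (fun k _ => aux_diag n b (Fin.castSucc k) i
    (Fin.castSucc_lt_last k).ne hi)] at h
  simp only [Finset.sum_const, Finset.card_univ, Fintype.card_fin, nsmul_eq_mul, integral_const,
    smul_eq_mul, mul_one] at h
  have hm : (subSphere (n + 1) (b (Fin.last n))).real Set.univ = sphVol n := by
    rw [Measure.real, aux_subSphere_univ n hn _ (b.orthonormal.1 _), sphVol]
  rw [hm] at h
  rw [← h]
  field_simp

theorem aux_det (n : ℕ) (b : OrthonormalBasis (Fin (n + 1)) ℝ (Ed (n + 1)))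
    (v : Fin n → Ed (n + 1)) :
    detCols (n + 1) v (b (Fin.last n)) ^ 2 =
      ∑ p : Equiv.Perm (Fin (n + 1)) × Equiv.Perm (Fin (n + 1)),
        (((Equiv.Perm.sign p.1 : ℤ) : ℝ) * ((Equiv.Perm.sign p.2 : ℤ) : ℝ) *
          (if p.1 (Fin.last n) = Fin.last n then 1 else 0) *
          (if p.2 (Fin.last n) = Fin.last n then 1 else 0)) *
        ∏ k : Fin n, ((inner ℝ (b (p.1 k.castSucc)) (v k) : ℝ) *
          inner ℝ (b (p.2 k.castSucc)) (v k)) := by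
  let w : Fin (n + 1) → Ed (n + 1) := Fin.snoc (α := fun _ => Ed (n + 1)) v (b (Fin.last n))
  let A : Matrix (Fin (n + 1)) (Fin (n + 1)) ℝ := Matrix.of fun i j => w j i
  let B : Matrix (Fin (n + 1)) (Fin (n + 1)) ℝ := Matrix.of fun i j => b i j
  let C : Matrix (Fin (n + 1)) (Fin (n + 1)) ℝ := Matrix.of fun i j => (inner ℝ (b i) (w j) : ℝ)
  have hA : detCols (n + 1) v (b (Fin.last n)) = A.det := by
    unfold detCols
    congr 1
    ext i j
    refine Fin.lastCases ?_ (fun j => ?_) j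
    · simp [A, w]
    · simp [A, w]
  have hC : C = B * A := by
    ext i j
    simp [C, B, A, Matrix.mul_apply, PiLp.inner_apply, mul_comm]
  have hB : B * B.transpose = 1 := by
    ext i j
    have := orthonormal_iff_ite.1 b.orthonormal i j
    simp only [PiLp.inner_apply, RCLike.inner_apply, conj_trivial] at this
    simp only [B, Matrix.mul_apply, Matrix.transpose_apply, Matrix.of_apply, Matrix.one_apply]
    rw [← this]
    exact Finset.sum_congr rfl fun k _ => mul_comm _ _
  have hB2 : B.det ^ 2 = 1 := by
    have := congrArg Matrix.det hB
    rw [Matrix.det_mul, Matrix.det_transpose, Matrix.det_one] at this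
    rw [sq, this]
  have hAC : A.det ^ 2 = C.det ^ 2 := by
    rw [hC, Matrix.det_mul, mul_pow, hB2, one_mul]
  have hCd : C.det = ∑ σ : Equiv.Perm (Fin (n + 1)), ((Equiv.Perm.sign σ : ℤ) : ℝ) *
      ((if σ (Fin.last n) = Fin.last n then 1 else 0) *
        ∏ k : Fin n, (inner ℝ (b (σ k.castSucc)) (v k) : ℝ)) := by
    rw [Matrix.det_apply']
    refine Finset.sum_congr rfl fun σ _ => ?_
    rw [Fin.prod_univ_castSucc]
    have h1 : C (σ (Fin.last n)) (Fin.last n) =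
        if σ (Fin.last n) = Fin.last n then 1 else 0 := by
      simp only [C, w, Matrix.of_apply, Fin.snoc_last]
      exact orthonormal_iff_ite.1 b.orthonormal _ _
    rw [h1, mul_comm (∏ k : Fin n, _)]
    simp [C, w]
  rw [hA, hAC, sq, hCd, Finset.sum_mul_sum, Fintype.sum_prod_type]
  refine Finset.sum_congr rfl fun σ _ => Finset.sum_congr rfl fun τ _ => ?_
  rw [Finset.prod_mul_distrib]
  ring

/-- number of permutations fixing the last point and the first one -/
def auxCount (m : ℕ) (a : Fin (m + 2)) : ℕ :=
  (Finset.univ.filter (fun σ : Equiv.Perm (Fin (m + 2)) =>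
    σ (Fin.last (m + 1)) = Fin.last (m + 1) ∧ σ 0 = a)).card

theorem auxCount_pos (m : ℕ) : 0 < auxCount m 0 :=
  Finset.card_pos.2 ⟨1, by simp⟩

theorem auxCount_eq (m : ℕ) (a : Fin (m + 2)) (ha : a ≠ Fin.last (m + 1)) :
    auxCount m a = auxCount m 0 := by
  have h0 : (0 : Fin (m + 2)) ≠ Fin.last (m + 1) := by simp [Fin.ext_iff]
  have hs : Equiv.swap a 0 (Fin.last (m + 1)) = Fin.last (m + 1) :=
    Equiv.swap_apply_of_ne_of_ne ha.symm h0.symm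
  refine Finset.card_bij' (fun σ _ => Equiv.swap a 0 * σ) (fun σ _ => Equiv.swap a 0 * σ)
    ?_ ?_ ?_ ?_
  · intro σ h
    simp only [Finset.mem_filter, Finset.mem_univ, true_and] at h
    simp [h.1, h.2, hs]
  · intro σ h
    simp only [Finset.mem_filter, Finset.mem_univ, true_and] at h
    simp [h.1, h.2, hs]
  · intro σ _; simp [← mul_assoc]
  · intro σ _; simp [← mul_assoc]

theorem aux_sum_perm (m : ℕ) (G : Fin (m + 2) → ℝ) (hG : G (Fin.last (m + 1)) = 0) :
    ∑ σ : Equiv.Perm (Fin (m + 2)),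
      (if σ (Fin.last (m + 1)) = Fin.last (m + 1) then G (σ 0) else 0) =
    auxCount m 0 * ∑ a, G a := by
  have h1 : ∀ σ : Equiv.Perm (Fin (m + 2)),
      (if σ (Fin.last (m + 1)) = Fin.last (m + 1) then G (σ 0) else 0) =
      ∑ a, (if σ (Fin.last (m + 1)) = Fin.last (m + 1) ∧ σ 0 = a then G a else 0) := by
    intro σ
    by_cases h : σ (Fin.last (m + 1)) = Fin.last (m + 1) <;> simp [h]
  simp only [h1]
  rw [Finset.sum_comm, Finset.mul_sum]
  refine Finset.sum_congr rfl fun a _ => ?_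
  rw [← Finset.sum_filter, Finset.sum_const, nsmul_eq_mul]
  by_cases ha : a = Fin.last (m + 1)
  · rw [ha, hG]; simp
  · rw [← auxCount_eq m a ha, auxCount]

theorem aux_perm_eq (m : ℕ) (σ τ : Equiv.Perm (Fin (m + 2)))
    (h : ∀ j, j ≠ 0 → σ j = τ j) : σ = τ := by
  ext j
  by_cases hj : j = 0
  · subst hj
    obtain ⟨k, hk⟩ := τ.surjective (σ 0)
    by_cases hk0 : k = 0
    · rw [← hk, hk0]
    · rw [← h k hk0] at hk
      exact absurd (σ.injective hk) hk0
  · rw [h j hj]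

theorem aux_QInt (m : ℕ) (g : Ed (m + 2) → ℝ) (hg : Continuous g) (x : Ed (m + 2))
    (hx : ‖x‖ = 1) :
    QInt (m + 2) (fun k => if (k : ℕ) = 0 then g else fun _ => 1) x =
      auxCount m 0 * (sphVol (m + 1) / ((m + 1 : ℕ) : ℝ)) ^ m *
        ∫ t, g t ∂ subSphere (m + 2) x := by
  obtain ⟨b, rfl⟩ := aux_basis (m + 1) x hx
  have hf := aux_subSphere_finite (m + 1) (by omega) (b (Fin.last (m + 1))) hx
  set μ := subSphere (m + 2) (b (Fin.last (m + 1))) with hμ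
  let gk : Fin (m + 1) → Ed (m + 2) → ℝ := fun k => if (k : ℕ) = 0 then g else fun _ => 1
  have hgk : ∀ k, Continuous (gk k) := by
    intro k
    by_cases h : (k : ℕ) = 0
    · simp only [gk, h, if_true]; exact hg
    · simp only [gk, h, if_false]; exact continuous_const
  have h1 : QInt (m + 2) (fun k => if (k : ℕ) = 0 then g else fun _ => 1) (b (Fin.last (m + 1))) =
      iterInt (m + 1) μ (fun v =>
      ∑ p : Equiv.Perm (Fin (m + 2)) × Equiv.Perm (Fin (m + 2)),
        (((Equiv.Perm.sign p.1 : ℤ) : ℝ) * ((Equiv.Perm.sign p.2 : ℤ) : ℝ) *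
          (if p.1 (Fin.last (m + 1)) = Fin.last (m + 1) then 1 else 0) *
          (if p.2 (Fin.last (m + 1)) = Fin.last (m + 1) then 1 else 0)) *
        ∏ k : Fin (m + 1), ((inner ℝ (b (p.1 k.castSucc)) (v k) : ℝ) *
          inner ℝ (b (p.2 k.castSucc)) (v k) * gk k (v k))) := by
    show iterInt (m + 1) μ (fun v => detCols (m + 1 + 1) v (b (Fin.last (m + 1))) ^ 2 *
      ∏ k : Fin (m + 1), gk k (v k)) = _
    congr 1
    funext v
    rw [aux_det, Finset.sum_mul]
    refine Finset.sum_congr rfl fun p _ => ?_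
    rw [Finset.prod_mul_distrib (g := fun k => gk k (v k)), mul_assoc]
  rw [h1, aux_iterInt μ (m + 1) _
    (fun (p : Equiv.Perm (Fin (m + 2)) × Equiv.Perm (Fin (m + 2))) k t =>
      (inner ℝ (b (p.1 k.castSucc)) t : ℝ) * inner ℝ (b (p.2 k.castSucc)) t * gk k t)
    (fun p k => aux_integrable _ _ _ (by have := hgk k; fun_prop))]
  set c : ℝ := sphVol (m + 1) / ((m + 1 : ℕ) : ℝ) with hc
  let G : Fin (m + 2) → ℝ := fun a => ∫ t, (inner ℝ (b a) t : ℝ) * inner ℝ (b a) t * g t ∂μ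
  have hGt : ∑ a, G a = ∫ t, g t ∂μ := aux_trace (m + 1) b g hg
  have hGl : G (Fin.last (m + 1)) = 0 := aux_last (m + 1) b g
  rw [← hGt, mul_right_comm, ← aux_sum_perm m G hGl, Finset.sum_mul, Fintype.sum_prod_type]
  refine Finset.sum_congr rfl fun σ _ => ?_
  by_cases hσ : σ (Fin.last (m + 1)) = Fin.last (m + 1)
  swap
  · simp [hσ]
  have hσne : ∀ k : Fin (m + 1), σ k.castSucc ≠ Fin.last (m + 1) := by
    intro k hk
    rw [← hσ] at hk
    exact (Fin.castSucc_lt_last k).ne (σ.injective hk)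
  rw [Finset.sum_eq_single σ]
  · have hs : ((Equiv.Perm.sign σ : ℤ) : ℝ) * ((Equiv.Perm.sign σ : ℤ) : ℝ) = 1 := by
      rw [← Int.cast_mul, Int.units_coe_mul_self, Int.cast_one]
    simp only [hσ, if_true, hs, mul_one, one_mul]
    rw [Fin.prod_univ_succ]
    congr 1
    rw [← Fin.prod_const]
    refine Finset.prod_congr rfl fun k _ => ?_
    have := aux_const (m + 1) (by omega) b _ (hσne k.succ)
    simp only [gk, Fin.val_succ, Nat.add_eq_zero_iff, one_ne_zero, and_false, if_false, mul_one]
    exact this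
  · intro τ _ hτ
    by_cases hτl : τ (Fin.last (m + 1)) = Fin.last (m + 1)
    swap
    · simp [hτl]
    apply mul_eq_zero_of_right
    have : ∃ k : Fin m, σ k.succ.castSucc ≠ τ k.succ.castSucc := by
      by_contra! hcon
      refine hτ (aux_perm_eq m σ τ ?_).symm
      intro j
      refine Fin.lastCases (fun _ => by rw [hσ, hτl]) (fun j => ?_) j
      refine Fin.cases (fun h => absurd rfl h) (fun k _ => hcon k) j
    obtain ⟨k, hk⟩ := this
    apply Finset.prod_eq_zero (Finset.mem_univ k.succ)
    have := aux_offdiag (m + 1) b _ _ hk (hσne _)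
    simpa [gk] using this
  · simp

/-- **Equation (5).** `Q(g, 1[d-2]) = R(g)`: the `Q`-transform with one argument `g` and the
remaining `d-2` arguments equal to `1` is the normalized Radon transform of `g`. -/
theorem Q_one_arg_eq_radon (d : ℕ) (hd : 3 ≤ d) (g : Ed d → ℝ) (hg : Continuous g) :
    ∀ x : Ed d, ‖x‖ = 1 →
      Qfun d (fun k => if (k : ℕ) = 0 then g else fun _ => 1) x = Radon d g x := by
  intro x hx
  obtain ⟨m, rfl⟩ : ∃ m, d = m + 2 := ⟨d - 2, by omega⟩
  have h1 : (fun (_ : Fin (m + 2 - 1)) (_ : Ed (m + 2)) => (1 : ℝ)) =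
      fun (k : Fin (m + 2 - 1)) => if (k : ℕ) = 0 then (fun _ => 1) else fun _ => 1 := by
    funext k; simp
  have he : ‖(EuclideanSpace.single (⟨0, by omega⟩ : Fin (m + 2)) (1 : ℝ))‖ = 1 := by simp
  have hm : ∀ y : Ed (m + 2), ‖y‖ = 1 →
      (subSphere (m + 2) y).real Set.univ = sphVol (m + 1) := by
    intro y hy
    rw [Measure.real, aux_subSphere_univ (m + 1) (by omega) _ hy, sphVol]
  have hf := aux_subSphere_finite (m + 1) (by omega) x hx
  rw [Qfun, Radon, cQ, dif_pos (by omega : 0 < m + 2), h1,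
    aux_QInt m (fun _ => 1) continuous_const _ he, aux_QInt m g hg x hx, integral_const, hm _ he,
    smul_eq_mul, mul_one]
  show _ = (sphVol (m + 1))⁻¹ * _
  by_cases h0 : sphVol (m + 1) = 0
  · have : subSphere (m + 2) x = 0 := by
      have h := hm x hx
      rw [h0] at h
      exact Measure.measure_univ_eq_zero.1
        ((measureReal_eq_zero_iff (measure_ne_top _ _)).1 h)
    simp [this]
  · have hN : (auxCount m 0 : ℝ) ≠ 0 := by exact_mod_cast (auxCount_pos m).ne'
    have hn : ((m + 1 : ℕ) : ℝ) ≠ 0 := by positivity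
    field_simp

end
end
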